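/- Let k ∈ (0, k_max) and let q̂_k = p_{θ₁,θ₂} be the worst case localiser with parameter θ₂ < 0. Then every (ε-γ)-almost worst case density p satisfies B(p, q̂_k) ≤ γ − θ₂·ε, i.e., p lies in the Bregman ball of radius γ − θ₂·ε around q̂_k. -/

import Mathlib

open MeasureTheory Filter Set Topology
open scoped ENNReal

noncomputable section

variable {Ω : Type*} [MeasurableSpace Ω]

/-- The positive part of an extended real number, as a member of `ℝ≥0∞`. -/
def ePos (x : EReal) : ℝ≥0∞ := if x = ⊤ then ⊤ else ENNReal.ofReal x.toReal

/-- The (signed) integral of an extended-real-valued function: the integral of its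
positive part minus the integral of its negative part. -/
def eInt (μ : Measure Ω) (f : Ω → EReal) : EReal :=
  ((∫⁻ r, ePos (f r) ∂μ : ℝ≥0∞) : EReal) - ((∫⁻ r, ePos (-(f r)) ∂μ : ℝ≥0∞) : EReal)

/-- `p` is a probability density with respect to `μ`. -/
def IsDensity (μ : Measure Ω) (p : Ω → ℝ) : Prop :=
  Measurable p ∧ (∀ r, 0 ≤ p r) ∧ ∫⁻ r, ENNReal.ofReal (p r) ∂μ = 1

/-- `∫ p dμ` for a nonnegative function `p`. -/
def pInt (μ : Measure Ω) (p : Ω → ℝ) : ℝ≥0∞ := ∫⁻ r, ENNReal.ofReal (p r) ∂μ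

/-- The convex integral functional `H(p) = ∫ β(r, p(r)) μ(dr)`. -/
def Hfun (μ : Measure Ω) (β : Ω → ℝ → EReal) (p : Ω → ℝ) : EReal :=
  eInt μ (fun r => β r (p r))

/-- The expected payoff `∫ X p dμ`, as an extended real number. -/
def xInt (μ : Measure Ω) (X p : Ω → ℝ) : EReal :=
  eInt μ (fun r => ((X r * p r : ℝ) : EReal))

/-- The value function `F(b) = inf { H(p) : p density, ∫ X p dμ = b }`. -/
def Ffun (μ : Measure Ω) (β : Ω → ℝ → EReal) (X : Ω → ℝ) (b : ℝ) : EReal :=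
  ⨅ p : {p : Ω → ℝ // IsDensity μ p ∧ xInt μ X p = (b : EReal)}, Hfun μ β p.1

/-- The essential infimum `m` of `X`, as an extended real number. -/
def essInfX (μ : Measure Ω) (X : Ω → ℝ) : EReal := essInf (fun r => (X r : EReal)) μ

/-- The essential supremum `M` of `X`, as an extended real number. -/
def essSupX (μ : Measure Ω) (X : Ω → ℝ) : EReal := essSup (fun r => (X r : EReal)) μ

/-- `k_max = lim_{b ↓ m} F(b)`; since `F` is nonincreasing on `(m, b₀)`, this limit
equals the supremum of `F` over `(m, b₀)`. -/
def kmax (μ : Measure Ω) (β : Ω → ℝ → EReal) (X : Ω → ℝ) (b₀ : ℝ) : EReal :=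
  ⨆ b : {b : ℝ // essInfX μ X < (b : EReal) ∧ b < b₀}, Ffun μ β X b

/-- `V(k) = inf { ∫ X p dμ : p density, H(p) ≤ k }`. -/
def Vfun (μ : Measure Ω) (β : Ω → ℝ → EReal) (X : Ω → ℝ) (k : ℝ) : EReal :=
  ⨅ p : {p : Ω → ℝ // IsDensity μ p ∧ Hfun μ β p ≤ (k : EReal)}, xInt μ X p.1

/-- `W(λ) = inf { ∫ X p dμ + λ H(p) : p density }`. -/
def Wfun (μ : Measure Ω) (β : Ω → ℝ → EReal) (X : Ω → ℝ) (lam : ℝ) : EReal :=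
  ⨅ p : {p : Ω → ℝ // IsDensity μ p}, (xInt μ X p.1 + (lam : EReal) * Hfun μ β p.1)

/-- The convex conjugate `β*(r, τ) = sup_s (sτ − β(r,s))` of `β` in its second variable. -/
def conjβ (β : Ω → ℝ → EReal) (r : Ω) (τ : ℝ) : EReal :=
  ⨆ s : ℝ, (((s * τ : ℝ) : EReal) - β r s)

/-- `K(θ₁, θ₂) = ∫ β*(r, θ₁ + θ₂ X(r)) μ(dr)`. -/
def Kfun (μ : Measure Ω) (β : Ω → ℝ → EReal) (X : Ω → ℝ) (θ₁ θ₂ : ℝ) : EReal :=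
  eInt μ (fun r => conjβ β r (θ₁ + θ₂ * X r))

/-- `dom K = {(θ₁, θ₂) : K(θ₁,θ₂) < +∞}`. -/
def domK (μ : Measure Ω) (β : Ω → ℝ → EReal) (X : Ω → ℝ) : Set (ℝ × ℝ) :=
  {θ : ℝ × ℝ | Kfun μ β X θ.1 θ.2 < ⊤}

/-- `β'(r, +∞) = lim_{s ↑ ∞} β'(r,s)`; by monotonicity of the derivative of a convex
function this equals the supremum of `β'(r, ·)` over `(0, ∞)`. -/
def derivTop (β' : Ω → ℝ → ℝ) (r : Ω) : EReal := ⨆ s : {s : ℝ // 0 < s}, (β' r s.1 : EReal)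

/-- `β'(r, 0) = lim_{s ↓ 0} β'(r,s)`, the infimum of `β'(r, ·)` over `(0, ∞)`. -/
def derivZero (β' : Ω → ℝ → ℝ) (r : Ω) : EReal := ⨅ s : {s : ℝ // 0 < s}, (β' r s.1 : EReal)

/-- The parameter set `Θ`. -/
def ThetaSet (μ : Measure Ω) (β : Ω → ℝ → EReal) (β' : Ω → ℝ → ℝ) (X : Ω → ℝ) :
    Set (ℝ × ℝ) :=
  {θ ∈ domK μ β X | ∀ᵐ r ∂μ, ((θ.1 + θ.2 * X r : ℝ) : EReal) < derivTop β' r}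

/-- The generalised exponential family member `p_{θ₁,θ₂}(r) = (β*)'(r, θ₁ + θ₂ X(r))`,
where `ψ` denotes the derivative `(β*)'` of the conjugate in its second variable. -/
def pFam (ψ : Ω → ℝ → ℝ) (X : Ω → ℝ) (θ₁ θ₂ : ℝ) : Ω → ℝ :=
  fun r => ψ r (θ₁ + θ₂ * X r)

/-- `G(θ₂) = inf_{θ₁} [K(θ₁,θ₂) − θ₁]`. -/
def Gfun (μ : Measure Ω) (β : Ω → ℝ → EReal) (X : Ω → ℝ) (θ₂ : ℝ) : EReal :=
  ⨅ θ₁ : ℝ, (Kfun μ β X θ₁ θ₂ - (θ₁ : EReal))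

/-- `Θ₂ = dom G`, the projection of `dom K` to the `θ₂`-axis. -/
def Theta2 (μ : Measure Ω) (β : Ω → ℝ → EReal) (X : Ω → ℝ) : Set ℝ :=
  {θ₂ : ℝ | Gfun μ β X θ₂ < ⊤}

/-- The Bregman integrand `Δ_β(r, s, t)`; for `t = 0` it is defined as the limit `t ↓ 0`
(with `β'(r,0) = lim_{t↓0} β'(r,t)`), and if `β(r,0) = +∞` then `Δ_β(r,0,0) = 0` and
`Δ_β(r,s,0) = +∞` for `s > 0`. -/
def bregmanInt (β : Ω → ℝ → EReal) (β' : Ω → ℝ → ℝ) (r : Ω) (s t : ℝ) : EReal :=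
  if 0 < t then β r s - β r t - ((β' r t : EReal) * ((s - t : ℝ) : EReal))
  else if β r 0 = ⊤ then (if s = 0 then 0 else ⊤)
  else β r s - β r 0 - derivZero β' r * ((s : ℝ) : EReal)

/-- The (generalised) Bregman distance `B(p, q)`. -/
def Bdist (μ : Measure Ω) (β : Ω → ℝ → EReal) (β' : Ω → ℝ → ℝ) (p q : Ω → ℝ) : EReal :=
  eInt μ (fun r => bregmanInt β β' r (p r) (q r))

/-- The standing assumptions of the framework: `μ` is σ-finite; `β` is a normal convex
integrand (measurable in `r`; equal to `+∞` for `s < 0`; finite, strictly convex and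
differentiable with derivative `β'` on `(0,∞)`; right-continuous at `0`); `p₀` is a
density with finite expected payoff `b₀` satisfying `m < b₀ < M`; `H(p₀) = 0 ≤ H(p)`
for every density `p`; and `k_max > 0`. -/
structure Standing (μ : Measure Ω) (β : Ω → ℝ → EReal) (β' : Ω → ℝ → ℝ)
    (X : Ω → ℝ) (p₀ : Ω → ℝ) (b₀ : ℝ) : Prop where
  sigma : SigmaFinite μ
  betaMeas : ∀ s : ℝ, Measurable (fun r => β r s)
  Xmeas : Measurable X
  betaNeg : ∀ r : Ω, ∀ s : ℝ, s < 0 → β r s = ⊤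
  betaNeBot : ∀ r s, β r s ≠ ⊥
  betaFin : ∀ r : Ω, ∀ s : ℝ, 0 < s → β r s ≠ ⊤
  betaZero : ∀ r, Tendsto (fun s => β r s) (𝓝[>] (0:ℝ)) (𝓝 (β r 0))
  betaConv : ∀ r, StrictConvexOn ℝ (Ioi (0:ℝ)) (fun s => (β r s).toReal)
  betaDeriv : ∀ r : Ω, ∀ s ∈ Ioi (0:ℝ), HasDerivAt (fun t => (β r t).toReal) (β' r s) s
  dens₀ : IsDensity μ p₀
  payoff₀ : xInt μ X p₀ = (b₀ : EReal)
  mlt : essInfX μ X < (b₀ : EReal)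
  ltM : (b₀ : EReal) < essSupX μ X
  H₀ : Hfun μ β p₀ = 0
  Hnonneg : ∀ p, IsDensity μ p → 0 ≤ Hfun μ β p
  kmaxPos : 0 < kmax μ β X b₀

/-- The hypothesis that `ψ = (β*)'`: at every point `τ < β'(r,+∞)`, where the conjugate
`β*(r,·)` is finite and differentiable, `ψ r τ` is its derivative. -/
def IsConjDeriv (β : Ω → ℝ → EReal) (β' : Ω → ℝ → ℝ) (ψ : Ω → ℝ → ℝ) : Prop :=
  ∀ r : Ω, ∀ τ : ℝ, ((τ : ℝ) : EReal) < derivTop β' r →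
    HasDerivAt (fun t => (conjβ β r t).toReal) (ψ r τ) τ

/-- `(θ₁, θ₂)` with `θ₂ < 0` attains the double maximum
`max_{θ₂<0} max_{θ₁} (k + K(θ₁,θ₂) − θ₁)/θ₂` (whose value is `V(k)`); such a pair is a
parameter pair of the worst case localiser `q̂_k = p_{θ₁,θ₂}`. -/
def IsWCLParam (μ : Measure Ω) (β : Ω → ℝ → EReal) (X : Ω → ℝ) (k : ℝ) (θ₁ θ₂ : ℝ) : Prop :=
  θ₂ < 0 ∧ ∀ θ₁' θ₂' : ℝ, θ₂' < 0 →
    ((k : EReal) + Kfun μ β X θ₁' θ₂' - (θ₁' : EReal)) / ((θ₂' : ℝ) : EReal) ≤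
      ((k : EReal) + Kfun μ β X θ₁ θ₂ - (θ₁ : EReal)) / ((θ₂ : ℝ) : EReal)

/-- `p` is an (ε-γ)-almost worst case density for threshold `k`. -/
def AWCD (μ : Measure Ω) (β : Ω → ℝ → EReal) (X : Ω → ℝ) (k ε γ : ℝ) (p : Ω → ℝ) : Prop :=
  IsDensity μ p ∧ Hfun μ β p ≤ ((k + γ : ℝ) : EReal) ∧
    xInt μ X p ≤ Vfun μ β X k + (ε : EReal)

/-- Convergence locally in measure. -/
def TendstoLocallyInMeasure (μ : Measure Ω) (p : ℕ → Ω → ℝ) (q : Ω → ℝ) : Prop :=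
  ∀ C : Set Ω, MeasurableSet C → μ C < ⊤ → ∀ ε : ℝ, 0 < ε →
    Tendsto (fun n => μ {r ∈ C | ε < |p n r - q r|}) atTop (𝓝 0)

end

theorem ePos_mono {x y : EReal} (h : x ≤ y) : ePos x ≤ ePos y := by
  unfold ePos
  by_cases hy : y = ⊤
  · simp [hy]
  have hx : x ≠ ⊤ := fun hx => hy (top_le_iff.1 (hx ▸ h))
  rw [if_neg hx, if_neg hy]
  induction x with
  | bot => simp
  | top => exact absurd rfl hx
  | coe x =>
    induction y with
    | bot => simp at h
    | top => exact absurd rfl hy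
    | coe y => exact ENNReal.ofReal_le_ofReal (by simpa using h)

theorem ePos_coe (x : ℝ) : ePos (x : EReal) = ENNReal.ofReal x := by
  simp [ePos]

theorem ePos_top : ePos ⊤ = ⊤ := by simp [ePos]

theorem measurable_ePos : Measurable ePos := by
  unfold ePos
  exact Measurable.ite (measurableSet_singleton _) measurable_const
    (ENNReal.measurable_ofReal.comp measurable_ereal_toReal)

theorem eInt_mono_ae {Ω : Type*} [MeasurableSpace Ω] {μ : Measure Ω} {f g : Ω → EReal}
    (h : ∀ᵐ r ∂μ, f r ≤ g r) : eInt μ f ≤ eInt μ g := by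
  unfold eInt
  refine EReal.sub_le_sub ?_ ?_
  · exact EReal.coe_ennreal_le_coe_ennreal_iff.2
      (lintegral_mono_ae (h.mono fun r hr => ePos_mono hr))
  · exact EReal.coe_ennreal_le_coe_ennreal_iff.2
      (lintegral_mono_ae (h.mono fun r hr => ePos_mono (EReal.neg_le_neg_iff.2 hr)))

theorem eInt_congr_ae {Ω : Type*} [MeasurableSpace Ω] {μ : Measure Ω} {f g : Ω → EReal}
    (h : f =ᵐ[μ] g) : eInt μ f = eInt μ g :=
  le_antisymm (eInt_mono_ae h.le) (eInt_mono_ae h.symm.le)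

theorem coe_ennreal_eq_coe_toReal {a : ℝ≥0∞} (ha : a ≠ ⊤) : (a : EReal) = (a.toReal : EReal) := by
  lift a to NNReal using ha
  rfl

theorem eInt_coe {Ω : Type*} [MeasurableSpace Ω] {μ : Measure Ω} {g : Ω → ℝ}
    (hg : Integrable g μ) : eInt μ (fun r => (g r : EReal)) = ((∫ r, g r ∂μ : ℝ) : EReal) := by
  have h1 : ∫⁻ r, ENNReal.ofReal (g r) ∂μ ≠ ⊤ := hg.lintegral_lt_top.ne
  have h2 : ∫⁻ r, ENNReal.ofReal (-g r) ∂μ ≠ ⊤ := hg.neg.lintegral_lt_top.ne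
  unfold eInt
  simp only [← EReal.coe_neg, ePos_coe]
  rw [integral_eq_lintegral_pos_part_sub_lintegral_neg_part hg, EReal.coe_sub,
    coe_ennreal_eq_coe_toReal h1, coe_ennreal_eq_coe_toReal h2]

theorem integrable_of_lintegral_ofReal {Ω : Type*} [MeasurableSpace Ω] {μ : Measure Ω}
    {g : Ω → ℝ} (hm : Measurable g) (h1 : ∫⁻ r, ENNReal.ofReal (g r) ∂μ ≠ ⊤)
    (h2 : ∫⁻ r, ENNReal.ofReal (-g r) ∂μ ≠ ⊤) : Integrable g μ := by
  refine ⟨hm.aestronglyMeasurable, ?_⟩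
  rw [hasFiniteIntegral_iff_norm]
  have : ∀ r, ENNReal.ofReal ‖g r‖ = ENNReal.ofReal (g r) + ENNReal.ofReal (-g r) := by
    intro r
    rcases le_total 0 (g r) with h | h
    · rw [Real.norm_of_nonneg h, ENNReal.ofReal_of_nonpos (neg_nonpos.2 h), add_zero]
    · rw [Real.norm_of_nonpos h, ENNReal.ofReal_of_nonpos h, zero_add]
  simp only [this]
  rw [lintegral_add_left (by fun_prop)]
  exact ENNReal.add_lt_top.2 ⟨h1.lt_top, h2.lt_top⟩

/-- A measurable extended-real function with finite positive and negative parts is a.e. real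
and integrable. -/
theorem ae_eq_coe_of_lintegral_ePos {Ω : Type*} [MeasurableSpace Ω] {μ : Measure Ω}
    {f : Ω → EReal} (hm : Measurable f) (h1 : ∫⁻ r, ePos (f r) ∂μ ≠ ⊤)
    (h2 : ∫⁻ r, ePos (-(f r)) ∂μ ≠ ⊤) :
    (∀ᵐ r ∂μ, f r = ((f r).toReal : EReal)) ∧ Integrable (fun r => (f r).toReal) μ := by
  have m1 : Measurable fun r => ePos (f r) := measurable_ePos.comp hm
  have m2 : Measurable fun r => ePos (-(f r)) := measurable_ePos.comp hm.neg
  have hae : ∀ᵐ r ∂μ, f r = ((f r).toReal : EReal) := by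
    filter_upwards [ae_lt_top m1 h1, ae_lt_top m2 h2] with r hr1 hr2
    refine (EReal.coe_toReal ?_ ?_).symm
    · intro h; simp [h, ePos_top] at hr1
    · intro h; simp [h, ePos_top] at hr2
  refine ⟨hae, integrable_of_lintegral_ofReal hm.ereal_toReal ?_ ?_⟩
  · rwa [lintegral_congr_ae (g := fun r => ePos (f r))]
    filter_upwards [hae] with r hr
    rw [hr, ePos_coe, EReal.toReal_coe]
  · rwa [lintegral_congr_ae (g := fun r => ePos (-(f r)))]
    filter_upwards [hae] with r hr
    rw [hr, ← EReal.coe_neg, ePos_coe, EReal.toReal_coe]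

theorem lintegral_ePos_neg_ne_top {Ω : Type*} [MeasurableSpace Ω] {μ : Measure Ω}
    {f : Ω → EReal} (h : eInt μ f ≠ ⊥) : ∫⁻ r, ePos (-(f r)) ∂μ ≠ ⊤ := by
  intro h'
  apply h
  unfold eInt
  rw [h']
  simp

theorem lintegral_ePos_ne_top {Ω : Type*} [MeasurableSpace Ω] {μ : Measure Ω}
    {f : Ω → EReal} (h2 : ∫⁻ r, ePos (-(f r)) ∂μ ≠ ⊤) (h : eInt μ f ≠ ⊤) :
    ∫⁻ r, ePos (f r) ∂μ ≠ ⊤ := by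
  intro h'
  apply h
  unfold eInt
  rw [h', coe_ennreal_eq_coe_toReal h2]
  simp

/-- A finite `eInt` is an honest Bochner integral. -/
theorem eInt_finite {Ω : Type*} [MeasurableSpace Ω] {μ : Measure Ω}
    {f : Ω → EReal} (hm : Measurable f) (hb : eInt μ f ≠ ⊥) (ht : eInt μ f ≠ ⊤) :
    (∀ᵐ r ∂μ, f r = ((f r).toReal : EReal)) ∧ Integrable (fun r => (f r).toReal) μ ∧
      eInt μ f = ((∫ r, (f r).toReal ∂μ : ℝ) : EReal) := by
  have h2 := lintegral_ePos_neg_ne_top hb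
  obtain ⟨hae, hi⟩ := ae_eq_coe_of_lintegral_ePos hm (lintegral_ePos_ne_top h2 ht) h2
  exact ⟨hae, hi, by rw [eInt_congr_ae hae, eInt_coe hi]⟩


section Pointwise

variable {Ω : Type*} [MeasurableSpace Ω] {μ : Measure Ω} {β : Ω → ℝ → EReal} {β' : Ω → ℝ → ℝ}
  {X p₀ : Ω → ℝ} {b₀ : ℝ}

namespace Standing

theorem coe_toReal_beta (hst : Standing μ β β' X p₀ b₀) (r : Ω) {s : ℝ} (hs : 0 < s) :
    ((β r s).toReal : EReal) = β r s :=
  EReal.coe_toReal (hst.betaFin r s hs) (hst.betaNeBot r s)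

theorem tendsto_beta_right (hst : Standing μ β β' X p₀ b₀) (r : Ω) {s : ℝ} (hs : 0 ≤ s) :
    Tendsto (fun t => β r t) (𝓝[>] s) (𝓝 (β r s)) := by
  rcases hs.eq_or_lt with rfl | hs
  · exact hst.betaZero r
  have h := ((hst.betaDeriv r s hs).continuousAt.tendsto).mono_left
    (nhdsWithin_le_nhds (s := Ioi s))
  have h2 := (continuous_coe_real_ereal.tendsto _).comp h
  rw [hst.coe_toReal_beta r hs] at h2
  refine h2.congr' ?_
  filter_upwards [self_mem_nhdsWithin] with t ht
  exact hst.coe_toReal_beta r (hs.trans ht)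

theorem tendsto_beta_add (hst : Standing μ β β' X p₀ b₀) (r : Ω) {s : ℝ} (hs : 0 ≤ s) :
    Tendsto (fun η => β r (s + η)) (𝓝[>] 0) (𝓝 (β r s)) := by
  refine (hst.tendsto_beta_right r hs).comp (tendsto_nhdsWithin_iff.2 ⟨?_, ?_⟩)
  · have : Tendsto (fun η : ℝ => s + η) (𝓝 0) (𝓝 (s + 0)) := by
      exact (continuous_const.add continuous_id).tendsto 0
    rw [add_zero] at this
    exact this.mono_left nhdsWithin_le_nhds
  · filter_upwards [self_mem_nhdsWithin] with η hη
    exact lt_add_of_pos_right s (show (0:ℝ) < η from hη)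

theorem tangent_le (hst : Standing μ β β' X p₀ b₀) (r : Ω) {s : ℝ} (hs : 0 < s) (t : ℝ) :
    (((β r s).toReal + β' r s * (t - s) : ℝ) : EReal) ≤ β r t := by
  have key : ∀ t : ℝ, 0 < t → (β r s).toReal + β' r s * (t - s) ≤ (β r t).toReal := by
    intro t ht
    have hc := (hst.betaConv r).convexOn
    rcases lt_trichotomy s t with h | h | h
    · have := hc.le_slope_of_hasDerivAt hs ht h (hst.betaDeriv r s hs)
      rw [slope_def_field, le_div_iff₀ (sub_pos.2 h)] at this
      linarith
    · subst h; simp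
    · have := hc.slope_le_of_hasDerivAt ht hs h (hst.betaDeriv r s hs)
      rw [slope_def_field, div_le_iff₀ (sub_pos.2 h)] at this
      linarith
  rcases lt_or_ge t 0 with ht | ht
  · rw [hst.betaNeg r t ht]; exact le_top
  refine le_of_tendsto_of_tendsto
    (f := fun η => (((β r s).toReal + β' r s * (t + η - s) : ℝ) : EReal))
    ?_ (hst.tendsto_beta_add r ht) ?_
  · have : Continuous fun η : ℝ => (((β r s).toReal + β' r s * (t + η - s) : ℝ) : EReal) :=
      continuous_coe_real_ereal.comp (by fun_prop)
    have h := this.tendsto 0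
    simp only [add_zero] at h
    exact h.mono_left nhdsWithin_le_nhds
  · filter_upwards [self_mem_nhdsWithin] with η hη
    have hη : 0 < t + η := add_pos_of_nonneg_of_pos ht hη
    rw [← hst.coe_toReal_beta r hη]
    exact EReal.coe_le_coe_iff.2 (key _ hη)

theorem beta_mix_le (hst : Standing μ β β' X p₀ b₀) (r : Ω) {s t u w c d : ℝ} (hs : 0 ≤ s)
    (ht : 0 ≤ t) (hc : 0 ≤ c) (hd : 0 ≤ d) (hcd : c + d = 1) (hu : β r s ≤ (u : EReal))
    (hw : β r t ≤ (w : EReal)) : β r (c * s + d * t) ≤ ((c * u + d * w : ℝ) : EReal) := by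
  have hs' : ((β r s).toReal : EReal) = β r s :=
    EReal.coe_toReal (ne_top_of_le_ne_top (EReal.coe_ne_top u) hu) (hst.betaNeBot r s)
  have ht' : ((β r t).toReal : EReal) = β r t :=
    EReal.coe_toReal (ne_top_of_le_ne_top (EReal.coe_ne_top w) hw) (hst.betaNeBot r t)
  have h1 : Tendsto (fun η => (β r (s + η)).toReal) (𝓝[>] 0) (𝓝 (β r s).toReal) :=
    (EReal.tendsto_toReal (ne_top_of_le_ne_top (EReal.coe_ne_top u) hu)
      (hst.betaNeBot r s)).comp (hst.tendsto_beta_add r hs)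
  have h2 : Tendsto (fun η => (β r (t + η)).toReal) (𝓝[>] 0) (𝓝 (β r t).toReal) :=
    (EReal.tendsto_toReal (ne_top_of_le_ne_top (EReal.coe_ne_top w) hw)
      (hst.betaNeBot r t)).comp (hst.tendsto_beta_add r ht)
  have h3 : Tendsto (fun η => ((c * (β r (s + η)).toReal + d * (β r (t + η)).toReal : ℝ) : EReal))
      (𝓝[>] 0) (𝓝 ((c * (β r s).toReal + d * (β r t).toReal : ℝ) : EReal)) :=
    (continuous_coe_real_ereal.tendsto _).comp ((h1.const_mul c).add (h2.const_mul d))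
  have hm : 0 ≤ c * s + d * t := by positivity
  refine (le_of_tendsto_of_tendsto (hst.tendsto_beta_add r hm) h3 ?_).trans ?_
  · filter_upwards [self_mem_nhdsWithin] with η hη
    have hη : (0:ℝ) < η := hη
    have e : c * s + d * t + η = c • (s + η) + d • (t + η) := by
      simp only [smul_eq_mul]; linear_combination (-η) * hcd
    rw [← hst.coe_toReal_beta r (by positivity), e]
    refine EReal.coe_le_coe_iff.2 ?_
    exact (hst.betaConv r).convexOn.2 (show (0:ℝ) < s + η by positivity)
      (show (0:ℝ) < t + η by positivity) hc hd hcd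
  · rw [← hs'] at hu
    rw [← ht'] at hw
    rw [EReal.coe_le_coe_iff] at *
    gcongr

theorem coe_le_conj (hst : Standing μ β β' X p₀ b₀) (r : Ω) {s : ℝ} (hs : β r s ≠ ⊤) (τ : ℝ) :
    ((s * τ - (β r s).toReal : ℝ) : EReal) ≤ conjβ β r τ := by
  refine le_trans (le_of_eq ?_) (le_iSup (fun s : ℝ => ((s * τ : ℝ) : EReal) - β r s) s)
  rw [EReal.coe_sub, EReal.coe_toReal hs (hst.betaNeBot r s)]

theorem conj_ne_bot (hst : Standing μ β β' X p₀ b₀) (r : Ω) (τ : ℝ) : conjβ β r τ ≠ ⊥ := fun h => by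
  have := hst.coe_le_conj r (hst.betaFin r 1 one_pos) τ
  rw [h] at this
  exact EReal.coe_ne_bot _ (le_bot_iff.1 this)

theorem conj_le_of_forall_pos (hst : Standing μ β β' X p₀ b₀) (r : Ω) (τ : ℝ) {a : EReal}
    (h : ∀ s : ℝ, 0 < s → ((s * τ - (β r s).toReal : ℝ) : EReal) ≤ a) : conjβ β r τ ≤ a := by
  refine iSup_le fun s => ?_
  rcases lt_or_ge s 0 with hs | hs
  · rw [hst.betaNeg r s hs, EReal.sub_top]; exact bot_le
  by_cases ht : β r s = ⊤
  · rw [ht, EReal.sub_top]; exact bot_le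
  have h1 : Tendsto (fun η => (β r (s + η)).toReal) (𝓝[>] 0) (𝓝 (β r s).toReal) :=
    (EReal.tendsto_toReal ht (hst.betaNeBot r s)).comp (hst.tendsto_beta_add r hs)
  have h2 : Tendsto (fun η : ℝ => (s + η) * τ) (𝓝[>] 0) (𝓝 (s * τ)) := by
    have : Continuous fun η : ℝ => (s + η) * τ := by fun_prop
    have h := this.tendsto 0
    simp only [add_zero] at h
    exact h.mono_left nhdsWithin_le_nhds
  have h3 := (continuous_coe_real_ereal.tendsto _).comp (h2.sub h1)
  rw [← EReal.coe_toReal ht (hst.betaNeBot r s), ← EReal.coe_sub]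
  refine le_of_tendsto h3 ?_
  filter_upwards [self_mem_nhdsWithin] with η hη
  exact h _ (add_pos_of_nonneg_of_pos hs hη)

theorem conj_le_of_forall_rat (hst : Standing μ β β' X p₀ b₀) (r : Ω) (τ : ℝ) {a : EReal}
    (h : ∀ q : ℚ, 0 < q → (((q : ℝ) * τ - (β r q).toReal : ℝ) : EReal) ≤ a) :
    conjβ β r τ ≤ a := by
  refine hst.conj_le_of_forall_pos r τ fun s hs => ?_
  have hcont : ContinuousAt (fun s : ℝ => ((s * τ - (β r s).toReal : ℝ) : EReal)) s :=
    continuous_coe_real_ereal.continuousAt.comp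
      ((continuousAt_id.mul continuousAt_const).sub (hst.betaDeriv r s hs).continuousAt)
  by_contra! hlt
  obtain ⟨q, ⟨hq1, hq2⟩⟩ := ((hcont.eventually (lt_mem_nhds hlt)).and
    (lt_mem_nhds hs)).exists_mem.elim fun U hU => by
      obtain ⟨V, hVU, hVo, hsV⟩ := mem_nhds_iff.1 hU.1
      obtain ⟨q, hq⟩ := Rat.denseRange_cast.exists_mem_open hVo ⟨s, hsV⟩
      exact (⟨q, hU.2 _ (hVU hq)⟩ : ∃ q : ℚ,
        a < (((q : ℝ) * τ - (β r q).toReal : ℝ) : EReal) ∧ (0:ℝ) < q)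
  exact absurd (h q (by exact_mod_cast hq2)) (not_le.2 hq1)

theorem conj_mono (hst : Standing μ β β' X p₀ b₀) (r : Ω) {τ τ' : ℝ} (h : τ ≤ τ') :
    conjβ β r τ ≤ conjβ β r τ' := by
  refine hst.conj_le_of_forall_pos r τ fun s hs => ?_
  refine le_trans ?_ (hst.coe_le_conj r (hst.betaFin r s hs) τ')
  rw [EReal.coe_le_coe_iff]
  gcongr

theorem conj_betaDeriv (hst : Standing μ β β' X p₀ b₀) (r : Ω) {s : ℝ} (hs : 0 < s) :
    conjβ β r (β' r s) = ((s * β' r s - (β r s).toReal : ℝ) : EReal) := by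
  refine le_antisymm (hst.conj_le_of_forall_pos r _ fun t ht => ?_)
    (hst.coe_le_conj r (hst.betaFin r s hs) _)
  have := hst.tangent_le r hs t
  rw [← hst.coe_toReal_beta r ht, EReal.coe_le_coe_iff] at this
  rw [EReal.coe_le_coe_iff]
  linarith

theorem betaDeriv_strictMono (hst : Standing μ β β' X p₀ b₀) (r : Ω) {s t : ℝ} (hs : 0 < s)
    (hst' : s < t) : β' r s < β' r t := by
  have h := (hst.betaConv r).strictMonoOn_deriv
    (fun x hx => (hst.betaDeriv r x hx).differentiableAt) hs (hs.trans hst') hst'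
  rwa [(hst.betaDeriv r s hs).deriv, (hst.betaDeriv r t (hs.trans hst')).deriv] at h

/-- Below `β'(r,+∞)` the supremum defining the conjugate is attained. -/
theorem exists_conj_eq (hst : Standing μ β β' X p₀ b₀) (r : Ω) {τ : ℝ}
    (hτ : (τ : EReal) < derivTop β' r) :
    ∃ s : ℝ, β r s ≠ ⊤ ∧ conjβ β r τ = ((s * τ - (β r s).toReal : ℝ) : EReal) ∧
      ((0 < s ∧ β' r s = τ) ∨ (s = 0 ∧ ∀ t, 0 < t → τ < β' r t)) := by
  obtain ⟨⟨s₁, hs₁⟩, h1⟩ := lt_iSup_iff.1 hτ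
  rw [EReal.coe_lt_coe_iff] at h1
  by_cases hex : ∃ s, 0 < s ∧ β' r s = τ
  · obtain ⟨s, hs, rfl⟩ := hex
    exact ⟨s, hst.betaFin r s hs, hst.conj_betaDeriv r hs, Or.inl ⟨hs, rfl⟩⟩
  push Not at hex
  have hall : ∀ t, 0 < t → τ < β' r t := by
    rcases hasDerivWithinAt_forall_lt_or_forall_gt_of_forall_ne (convex_Ioi (0:ℝ))
      (fun x hx => (hst.betaDeriv r x hx).hasDerivWithinAt) hex with h | h
    · exact absurd (h s₁ hs₁) (not_lt.2 h1.le)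
    · exact h
  have hmono : ∀ s t, 0 < s → s < t → s * τ - (β r s).toReal ≥ t * τ - (β r t).toReal := by
    intro s t hs ht
    have := hst.tangent_le r hs t
    rw [← hst.coe_toReal_beta r (hs.trans ht), EReal.coe_le_coe_iff] at this
    nlinarith [hall s hs]
  have hle0 : ∀ t, 0 < t → β r 0 ≤ (((β r t).toReal - t * τ : ℝ) : EReal) := by
    intro t ht
    have hl : Tendsto (fun s : ℝ => ((s * τ + ((β r t).toReal - t * τ) : ℝ) : EReal)) (𝓝[>] 0)
        (𝓝 (((β r t).toReal - t * τ : ℝ) : EReal)) := by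
      have : Continuous fun s : ℝ => ((s * τ + ((β r t).toReal - t * τ) : ℝ) : EReal) :=
        continuous_coe_real_ereal.comp (by fun_prop)
      have h := this.tendsto 0
      simp only [zero_mul, zero_add] at h
      exact h.mono_left nhdsWithin_le_nhds
    refine le_of_tendsto_of_tendsto (hst.betaZero r) hl ?_
    filter_upwards [Ioo_mem_nhdsGT ht] with s hs
    rw [← hst.coe_toReal_beta r hs.1, EReal.coe_le_coe_iff]
    linarith [hmono s t hs.1 hs.2]
  have h0 : β r 0 ≠ ⊤ := ne_top_of_le_ne_top (EReal.coe_ne_top _) (hle0 1 one_pos)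
  refine ⟨0, h0, le_antisymm (hst.conj_le_of_forall_pos r τ fun t ht => ?_)
    (hst.coe_le_conj r h0 τ), Or.inr ⟨rfl, hall⟩⟩
  have := hle0 t ht
  rw [← EReal.coe_toReal h0 (hst.betaNeBot r 0), EReal.coe_le_coe_iff] at this
  rw [EReal.coe_le_coe_iff]
  linarith

theorem conj_ne_top (hst : Standing μ β β' X p₀ b₀) (r : Ω) {τ : ℝ}
    (hτ : (τ : EReal) < derivTop β' r) : conjβ β r τ ≠ ⊤ := by
  obtain ⟨s, -, h, -⟩ := hst.exists_conj_eq r hτ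
  rw [h]
  exact EReal.coe_ne_top _

/-- A point attaining the supremum in the conjugate is the derivative of the conjugate. -/
theorem conjDeriv_eq (hst : Standing μ β β' X p₀ b₀) {ψ : Ω → ℝ → ℝ} (hψ : IsConjDeriv β β' ψ)
    (r : Ω) {τ s : ℝ} (hτ : (τ : EReal) < derivTop β' r) (hs : β r s ≠ ⊤)
    (h : conjβ β r τ = ((s * τ - (β r s).toReal : ℝ) : EReal)) : ψ r τ = s := by
  have hd : HasDerivAt (fun t => (conjβ β r t).toReal - s * t) (ψ r τ - s) τ := by
    have := (hψ r τ hτ).sub ((hasDerivAt_id τ).const_mul s)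
    rwa [mul_one] at this
  have hmin : IsLocalMin (fun t => (conjβ β r t).toReal - s * t) τ := by
    have hev : ∀ᶠ t : ℝ in 𝓝 τ, (t : EReal) < derivTop β' r :=
      continuous_coe_real_ereal.continuousAt.eventually (gt_mem_nhds hτ)
    filter_upwards [hev] with t ht
    have h2 := hst.coe_le_conj r hs t
    rw [← EReal.coe_toReal (hst.conj_ne_top r ht) (hst.conj_ne_bot r t),
      EReal.coe_le_coe_iff] at h2
    rw [h, EReal.toReal_coe]
    linarith
  linarith [hmin.hasDerivAt_eq_zero hd]

/-- The Bregman integrand at the derivative of the conjugate is at most the Fenchel gap. -/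
theorem bregmanInt_le (hst : Standing μ β β' X p₀ b₀) {ψ : Ω → ℝ → ℝ} (hψ : IsConjDeriv β β' ψ)
    (r : Ω) {τ y : ℝ} (hτ : (τ : EReal) < derivTop β' r) (hy : 0 ≤ y) (hβ : β r y ≠ ⊤) :
    bregmanInt β β' r y (ψ r τ) ≤
      (((β r y).toReal - τ * y + (conjβ β r τ).toReal : ℝ) : EReal) := by
  obtain ⟨s, hs, hc, hcase⟩ := hst.exists_conj_eq r hτ
  rw [hst.conjDeriv_eq hψ r hτ hs hc, hc, EReal.toReal_coe]
  unfold bregmanInt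
  rcases hcase with ⟨hs0, rfl⟩ | ⟨rfl, hall⟩
  · rw [if_pos hs0, ← EReal.coe_toReal hβ (hst.betaNeBot r y),
      ← EReal.coe_toReal hs (hst.betaNeBot r s), ← EReal.coe_mul, ← EReal.coe_sub,
      ← EReal.coe_sub, EReal.coe_le_coe_iff, EReal.toReal_coe, EReal.toReal_coe]
    linarith
  · rw [if_neg (lt_irrefl _), if_neg hs]
    have h1 : (τ : EReal) ≤ derivZero β' r :=
      le_iInf fun t => EReal.coe_le_coe_iff.2 (hall t.1 t.2).le
    have h2 : ((τ * y : ℝ) : EReal) ≤ derivZero β' r * (y : EReal) := by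
      rw [EReal.coe_mul]
      exact mul_le_mul_of_nonneg_right h1 (EReal.coe_nonneg.2 hy)
    refine (EReal.sub_le_sub le_rfl h2).trans ?_
    rw [← EReal.coe_toReal hβ (hst.betaNeBot r y),
      ← EReal.coe_toReal hs (hst.betaNeBot r 0), ← EReal.coe_sub,
      ← EReal.coe_sub, EReal.coe_le_coe_iff, EReal.toReal_coe, EReal.toReal_coe]
    linarith

/-- At or beyond `β'(r,+∞)` the left difference quotients of the conjugate blow up. -/
theorem eventually_le_conj_diff (hst : Standing μ β β' X p₀ b₀) (r : Ω) {τ : ℝ}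
    (hτ : derivTop β' r ≤ (τ : EReal)) (hfin : conjβ β r τ ≠ ⊤) {S : ℝ} (hS : 0 < S) :
    ∀ᶠ n : ℕ in atTop, S ≤ ((n : ℝ) + 1) *
      ((conjβ β r τ).toReal - (conjβ β r (τ - 1 / ((n : ℝ) + 1))).toReal) := by
  have hlt : β' r S < τ := by
    have h1 : ((β' r (S + 1) : ℝ) : EReal) ≤ derivTop β' r :=
      le_iSup (fun s : {s : ℝ // 0 < s} => (β' r s.1 : EReal)) ⟨S + 1, by positivity⟩
    have := hst.betaDeriv_strictMono r hS (lt_add_one S)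
    have h2 := EReal.coe_le_coe_iff.1 (h1.trans hτ)
    linarith
  have hev := (tendsto_one_div_add_atTop_nhds_zero_nat (𝕜 := ℝ)).eventually
    (gt_mem_nhds (sub_pos.2 hlt))
  filter_upwards [hev] with n hn
  set δ : ℝ := 1 / ((n : ℝ) + 1) with hδ
  have hδpos : 0 < δ := by positivity
  have hc : ((conjβ β r τ).toReal : EReal) = conjβ β r τ :=
    EReal.coe_toReal hfin (hst.conj_ne_bot r τ)
  have hreal : ∀ s, 0 < s → s * τ - (β r s).toReal ≤ (conjβ β r τ).toReal := by
    intro s hs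
    have := hst.coe_le_conj r (hst.betaFin r s hs) τ
    rwa [← hc, EReal.coe_le_coe_iff] at this
  have hle : conjβ β r (τ - δ) ≤ (((conjβ β r τ).toReal - δ * S : ℝ) : EReal) := by
    refine hst.conj_le_of_forall_pos r _ fun s hs => ?_
    rw [EReal.coe_le_coe_iff]
    rcases le_total S s with h | h
    · nlinarith [hreal s hs]
    · have h1 := hreal S hS
      have h2 := hst.tangent_le r hS s
      rw [← hst.coe_toReal_beta r hs, EReal.coe_le_coe_iff] at h2
      nlinarith
  have hne : conjβ β r (τ - δ) ≠ ⊤ := ne_top_of_le_ne_top (EReal.coe_ne_top _) hle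
  rw [← EReal.coe_toReal hne (hst.conj_ne_bot r _), EReal.coe_le_coe_iff] at hle
  have hn1 : ((n : ℝ) + 1) * δ = 1 := by rw [hδ]; field_simp
  calc S = ((n : ℝ) + 1) * (δ * S) := by rw [← mul_assoc, hn1, one_mul]
    _ ≤ _ := by gcongr; linarith

theorem measurable_beta_comp (hst : Standing μ β β' X p₀ b₀) {p : Ω → ℝ} (hp : Measurable p)
    (hp0 : ∀ r, 0 ≤ p r) : Measurable fun r => β r (p r) := by
  refine measurable_of_tendsto_metrizable
    (f := fun (n : ℕ) r => β r ((⌊((n : ℝ) + 1) * p r⌋₊ + 1) / ((n : ℝ) + 1))) (fun n => ?_) ?_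
  · have h1 : Measurable fun z : Ω × ℕ => β z.1 (((z.2 : ℝ) + 1) / ((n : ℝ) + 1)) :=
      measurable_from_prod_countable_left fun m =>
        hst.betaMeas (((m : ℝ) + 1) / ((n : ℝ) + 1))
    exact h1.comp (measurable_id.prodMk (Nat.measurable_floor.comp (hp.const_mul _)))
  · rw [tendsto_pi_nhds]
    intro r
    refine (hst.tendsto_beta_right r (hp0 r)).comp (tendsto_nhdsWithin_iff.2 ⟨?_, ?_⟩)
    · have hlim : Tendsto (fun n : ℕ => p r + 1 / ((n : ℝ) + 1)) atTop (𝓝 (p r)) := by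
        simpa using tendsto_one_div_add_atTop_nhds_zero_nat.const_add (p r)
      refine tendsto_of_tendsto_of_tendsto_of_le_of_le tendsto_const_nhds hlim (fun n => ?_)
        fun n => ?_
      · change p r ≤ (_ : ℝ) / _
        rw [le_div_iff₀ (by positivity), mul_comm]
        exact (Nat.lt_floor_add_one _).le
      · change (_ : ℝ) / _ ≤ p r + 1 / ((n : ℝ) + 1)
        have hfl : (⌊((n : ℝ) + 1) * p r⌋₊ : ℝ) ≤ ((n : ℝ) + 1) * p r :=
          Nat.floor_le (mul_nonneg (by positivity) (hp0 r))
        rw [div_le_iff₀ (by positivity)]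
        refine (add_le_add_left hfl 1).trans (le_of_eq ?_)
        field_simp
    · refine Eventually.of_forall fun n => ?_
      change p r < (_ : ℝ) / _
      rw [lt_div_iff₀ (by positivity), mul_comm]
      exact Nat.lt_floor_add_one _

theorem measurable_conj_comp (hst : Standing μ β β' X p₀ b₀) {τ : Ω → ℝ} (hτ : Measurable τ) :
    Measurable fun r => conjβ β r (τ r) := by
  have : (fun r => conjβ β r (τ r)) = fun r => ⨆ q : {q : ℚ // 0 < q},
      ((((q.1 : ℝ) * τ r - (β r q.1).toReal : ℝ)) : EReal) := by
    funext r
    refine le_antisymm (hst.conj_le_of_forall_rat r _ fun q hq => ?_) (iSup_le fun q => ?_)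
    · exact le_iSup (fun q : {q : ℚ // 0 < q} =>
        ((((q.1 : ℝ) * τ r - (β r q.1).toReal : ℝ)) : EReal)) ⟨q, hq⟩
    · exact hst.coe_le_conj r (hst.betaFin r _ (by exact_mod_cast q.2)) _
  rw [this]
  exact Measurable.iSup fun q => measurable_coe_real_ereal.comp
    ((hτ.const_mul _).sub (hst.betaMeas _).ereal_toReal)

end Standing

end Pointwise


/-- In finite dimension, a point outside a nonempty convex set is weakly separated from it by a
nonzero functional. -/
theorem exists_separating_functional {E : Type*} [NormedAddCommGroup E] [NormedSpace ℝ E]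
    [FiniteDimensional ℝ E] {S : Set E} (hS : Convex ℝ S) (hne : S.Nonempty) {x : E}
    (hx : x ∉ S) : ∃ f : E →ₗ[ℝ] ℝ, f ≠ 0 ∧ ∀ y ∈ S, f x ≤ f y := by
  by_cases hint : (interior S).Nonempty
  · obtain ⟨f, hf, h⟩ := geometric_hahn_banach_of_nonempty_interior_point hS
      (fun h => hx (interior_subset h)) hint
    refine ⟨-f.toLinearMap, ?_, fun y hy => by simpa using h y hy⟩
    rw [ne_eq, neg_eq_zero]
    intro h0
    exact hf (ContinuousLinearMap.ext fun z => LinearMap.congr_fun h0 z)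
  · obtain ⟨y₀, hy₀⟩ := hne
    have hspan : affineSpan ℝ S ≠ ⊤ := fun h =>
      hint ((hS.interior_nonempty_iff_affineSpan_eq_top).2 h)
    have hdir : (affineSpan ℝ S).direction < ⊤ := by
      rw [lt_top_iff_ne_top, ne_eq, AffineSubspace.direction_eq_top_iff_of_nonempty
        ⟨y₀, subset_affineSpan ℝ S hy₀⟩]
      exact hspan
    obtain ⟨g, hg0, hg⟩ := Submodule.exists_le_ker_of_lt_top _ hdir
    have hconst : ∀ y ∈ S, g y = g y₀ := by
      intro y hy
      have := hg (AffineSubspace.vsub_mem_direction (subset_affineSpan ℝ S hy)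
        (subset_affineSpan ℝ S hy₀))
      rw [LinearMap.mem_ker, vsub_eq_sub, map_sub] at this
      linarith
    rcases le_total (g x) (g y₀) with h | h
    · exact ⟨g, hg0, fun y hy => h.trans (hconst y hy).ge⟩
    · refine ⟨-g, neg_ne_zero.2 hg0, fun y hy => ?_⟩
      simpa [hconst y hy] using h

/-- `f` is a nonnegative integrable function with integrable payoff, and `u` is an integrable
upper bound for `β(·, f)`. -/
structure Admissible {Ω : Type*} [MeasurableSpace Ω] (μ : Measure Ω) (β : Ω → ℝ → EReal)
    (X f u : Ω → ℝ) : Prop where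
  meas : Measurable f
  nonneg : ∀ r, 0 ≤ f r
  int : Integrable f μ
  intX : Integrable (fun r => X r * f r) μ
  intu : Integrable u μ
  le : ∀ᵐ r ∂μ, β r (f r) ≤ (u r : EReal)

section Duality

variable {Ω : Type*} [MeasurableSpace Ω] {μ : Measure Ω} {β : Ω → ℝ → EReal} {β' : Ω → ℝ → ℝ}
  {X p₀ : Ω → ℝ} {b₀ : ℝ}

theorem IsDensity.integrable {p : Ω → ℝ} (hp : IsDensity μ p) : Integrable p μ := by
  refine integrable_of_lintegral_ofReal hp.1 (by rw [hp.2.2]; simp) ?_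
  have : ∀ r, ENNReal.ofReal (-p r) = 0 := fun r =>
    ENNReal.ofReal_of_nonpos (neg_nonpos.2 (hp.2.1 r))
  simp [this]

theorem IsDensity.integral_eq_one {p : Ω → ℝ} (hp : IsDensity μ p) : ∫ r, p r ∂μ = 1 := by
  rw [integral_eq_lintegral_of_nonneg_ae (Eventually.of_forall hp.2.1)
    hp.1.aestronglyMeasurable, hp.2.2, ENNReal.toReal_one]

theorem Admissible.isDensity {f u : Ω → ℝ} (h : Admissible μ β X f u) (h1 : ∫ r, f r ∂μ = 1) :
    IsDensity μ f := by
  refine ⟨h.meas, h.nonneg, ?_⟩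
  rw [← ofReal_integral_eq_lintegral_ofReal h.int (Eventually.of_forall h.nonneg), h1,
    ENNReal.ofReal_one]

theorem Admissible.Hfun_le {f u : Ω → ℝ} (h : Admissible μ β X f u) :
    Hfun μ β f ≤ ((∫ r, u r ∂μ : ℝ) : EReal) := by
  rw [← eInt_coe h.intu]
  exact eInt_mono_ae h.le

theorem Admissible.xInt_eq {f u : Ω → ℝ} (h : Admissible μ β X f u) :
    xInt μ X f = ((∫ r, X r * f r ∂μ : ℝ) : EReal) := eInt_coe h.intX

namespace Standing

theorem admissible_mix (hst : Standing μ β β' X p₀ b₀) {f u g w : Ω → ℝ}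
    (hf : Admissible μ β X f u) (hg : Admissible μ β X g w) {c d : ℝ} (hc : 0 ≤ c) (hd : 0 ≤ d)
    (hcd : c + d = 1) :
    Admissible μ β X (fun r => c * f r + d * g r) (fun r => c * u r + d * w r) where
  meas := (hf.meas.const_mul c).add (hg.meas.const_mul d)
  nonneg r := add_nonneg (mul_nonneg hc (hf.nonneg r)) (mul_nonneg hd (hg.nonneg r))
  int := (hf.int.const_mul c).add (hg.int.const_mul d)
  intX := by
    refine ((hf.intX.const_mul c).add (hg.intX.const_mul d)).congr (Eventually.of_forall fun r => ?_)
    simp only [Pi.add_apply]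
    ring
  intu := (hf.intu.const_mul c).add (hg.intu.const_mul d)
  le := by
    filter_upwards [hf.le, hg.le] with r h1 h2
    exact hst.beta_mix_le r (hf.nonneg r) (hg.nonneg r) hc hd hcd h1 h2

theorem integral_X_mix {f u g w : Ω → ℝ}
    (hf : Admissible μ β X f u) (hg : Admissible μ β X g w) (c d : ℝ) :
    ∫ r, X r * (c * f r + d * g r) ∂μ = c * ∫ r, X r * f r ∂μ + d * ∫ r, X r * g r ∂μ := by
  rw [← integral_const_mul, ← integral_const_mul,
    ← integral_add (hf.intX.const_mul c) (hg.intX.const_mul d)]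
  congr 1 with r
  ring

theorem integral_mix {f g : Ω → ℝ} (hf : Integrable f μ) (hg : Integrable g μ) (c d : ℝ) :
    ∫ r, (c * f r + d * g r) ∂μ = c * ∫ r, f r ∂μ + d * ∫ r, g r ∂μ := by
  rw [← integral_const_mul, ← integral_const_mul,
    ← integral_add (hf.const_mul c) (hg.const_mul d)]

theorem admissible_p₀ (hst : Standing μ β β' X p₀ b₀) :
    Admissible μ β X p₀ (fun r => (β r (p₀ r)).toReal) := by
  have hβm := hst.measurable_beta_comp hst.dens₀.1 hst.dens₀.2.1
  obtain ⟨h1, h2, -⟩ := eInt_finite hβm (by rw [show eInt μ _ = 0 from hst.H₀]; simp)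
    (by rw [show eInt μ _ = 0 from hst.H₀]; simp)
  obtain ⟨-, h3, -⟩ := eInt_finite (f := fun r => ((X r * p₀ r : ℝ) : EReal)) (μ := μ)
    (measurable_coe_real_ereal.comp (hst.Xmeas.mul hst.dens₀.1))
    (by rw [show eInt μ _ = (b₀ : EReal) from hst.payoff₀]; exact EReal.coe_ne_bot _)
    (by rw [show eInt μ _ = (b₀ : EReal) from hst.payoff₀]; exact EReal.coe_ne_top _)
  exact ⟨hst.dens₀.1, hst.dens₀.2.1, hst.dens₀.integrable, by simpa only [EReal.toReal_coe] using h3, h2,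
    h1.mono fun r hr => hr.le⟩

theorem integral_beta_p₀ (hst : Standing μ β β' X p₀ b₀) :
    ∫ r, (β r (p₀ r)).toReal ∂μ = 0 := by
  have hβm := hst.measurable_beta_comp hst.dens₀.1 hst.dens₀.2.1
  obtain ⟨-, -, h⟩ := eInt_finite hβm (by rw [show eInt μ _ = 0 from hst.H₀]; simp)
    (by rw [show eInt μ _ = 0 from hst.H₀]; simp)
  rw [show eInt μ _ = 0 from hst.H₀] at h
  exact_mod_cast h.symm

theorem integral_X_p₀ (hst : Standing μ β β' X p₀ b₀) : ∫ r, X r * p₀ r ∂μ = b₀ := by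
  have h := hst.admissible_p₀.xInt_eq
  rw [hst.payoff₀, EReal.coe_eq_coe_iff] at h
  exact h.symm

/-- The functional `f ↦ a ∫ f + c ∫ X f + d ∫ β(f)` as a single integral. -/
theorem integral_lagrangian {f u : Ω → ℝ} (h : Admissible μ β X f u) (a c d : ℝ) :
    Integrable (fun r => d * u r + (a + c * X r) * f r) μ ∧
      ∫ r, (d * u r + (a + c * X r) * f r) ∂μ =
        a * ∫ r, f r ∂μ + c * ∫ r, X r * f r ∂μ + d * ∫ r, u r ∂μ := by
  have e : (fun r => d * u r + (a + c * X r) * f r) =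
      fun r => a * f r + c * (X r * f r) + d * u r := by
    funext r; ring
  rw [e]
  have i1 : Integrable (fun r => a * f r + c * (X r * f r)) μ :=
    (h.int.const_mul a).add (h.intX.const_mul c)
  refine ⟨i1.add (h.intu.const_mul d), ?_⟩
  rw [integral_add i1 (h.intu.const_mul d), integral_add (h.int.const_mul a) (h.intX.const_mul c)]
  simp only [integral_const_mul]

end Standing

end Duality


/-- The running minimiser of `φ r` over the starting point `p r` and the values `q 0, …, q (n-1)`. -/
noncomputable def runningArgmin {Ω : Type*} (φ : Ω → ℝ → ℝ) (p : Ω → ℝ) (q : ℕ → ℝ) :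
    ℕ → Ω → ℝ
  | 0 => p
  | n + 1 => fun r =>
      if φ r (q n) < φ r (runningArgmin φ p q n r) then q n else runningArgmin φ p q n r

theorem runningArgmin_succ_le {Ω : Type*} (φ : Ω → ℝ → ℝ) (p : Ω → ℝ) (q : ℕ → ℝ) (n : ℕ) (r : Ω) :
    φ r (runningArgmin φ p q (n + 1) r) ≤ φ r (runningArgmin φ p q n r) ∧
      φ r (runningArgmin φ p q (n + 1) r) ≤ φ r (q n) := by
  simp only [runningArgmin]
  split_ifs with h
  · exact ⟨h.le, le_rfl⟩
  · exact ⟨le_rfl, not_lt.1 h⟩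

theorem runningArgmin_antitone {Ω : Type*} (φ : Ω → ℝ → ℝ) (p : Ω → ℝ) (q : ℕ → ℝ) (r : Ω) :
    Antitone fun n => φ r (runningArgmin φ p q n r) :=
  antitone_nat_of_succ_le fun n => (runningArgmin_succ_le φ p q n r).1

theorem runningArgmin_cases {Ω : Type*} (φ : Ω → ℝ → ℝ) (p : Ω → ℝ) (q : ℕ → ℝ) (n : ℕ) (r : Ω) :
    runningArgmin φ p q n r = p r ∨ ∃ m, runningArgmin φ p q n r = q m := by
  induction n with
  | zero => exact Or.inl rfl
  | succ n ih =>
    simp only [runningArgmin]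
    split_ifs with h
    · exact Or.inr ⟨n, rfl⟩
    · exact ih

section Interchange

variable {Ω : Type*} [MeasurableSpace Ω] {μ : Measure Ω} {β : Ω → ℝ → EReal} {β' : Ω → ℝ → ℝ}
  {X p₀ : Ω → ℝ} {b₀ : ℝ}

namespace Standing

/-- Replacing `p₀` on increasing sets by a competitor `f`: a lower bound for the Lagrangian over
admissible functions bounds the total gain of `f` over `p₀`. -/
theorem lintegral_gain_le (hst : Standing μ β β' X p₀ b₀) {a c d C : ℝ}
    (hC : ∀ f u, Admissible μ β X f u →
      C ≤ a * ∫ r, f r ∂μ + c * ∫ r, X r * f r ∂μ + d * ∫ r, u r ∂μ)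
    {f : Ω → ℝ} (hf : Measurable f) (hf0 : ∀ r, 0 ≤ f r) (hfin : ∀ᵐ r ∂μ, β r (f r) ≠ ⊤)
    (hle : ∀ r, d * (β r (f r)).toReal + (a + c * X r) * f r ≤
      d * (β r (p₀ r)).toReal + (a + c * X r) * p₀ r) :
    ∫⁻ r, ENNReal.ofReal ((d * (β r (p₀ r)).toReal + (a + c * X r) * p₀ r) -
        (d * (β r (f r)).toReal + (a + c * X r) * f r)) ∂μ ≤
      ENNReal.ofReal (∫ r, (d * (β r (p₀ r)).toReal + (a + c * X r) * p₀ r) ∂μ - C) := by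
  have hsig := hst.sigma
  have hXm := hst.Xmeas
  have h0 := hst.admissible_p₀
  have hbm : Measurable fun r => (β r (f r)).toReal := (hst.measurable_beta_comp hf hf0).ereal_toReal
  have hbm0 : Measurable fun r => (β r (p₀ r)).toReal :=
    (hst.measurable_beta_comp h0.meas h0.nonneg).ereal_toReal
  have hp₀m := h0.meas
  set ℓ : Ω → ℝ := fun r => (d * (β r (p₀ r)).toReal + (a + c * X r) * p₀ r) -
        (d * (β r (f r)).toReal + (a + c * X r) * f r) with hℓ
  have hℓ0 : ∀ r, 0 ≤ ℓ r := fun r => sub_nonneg.2 (hle r)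
  have hℓm : Measurable ℓ := by fun_prop
  set E : ℕ → Set Ω := fun j => spanningSets μ j ∩
    {r | |X r| ≤ j ∧ f r ≤ j ∧ |(β r (f r)).toReal| ≤ j} with hE
  have hEm : ∀ j, MeasurableSet (E j) := fun j =>
    (measurableSet_spanningSets μ j).inter
      ((measurableSet_le hXm.abs measurable_const).inter
        ((measurableSet_le hf measurable_const).inter
          (measurableSet_le hbm.abs measurable_const)))
  have hEmono : Monotone E := by
    intro i j hij r hr
    have : (i : ℝ) ≤ j := by exact_mod_cast hij
    exact ⟨monotone_spanningSets μ hij hr.1, hr.2.1.trans this, hr.2.2.1.trans this,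
      hr.2.2.2.trans this⟩
  have hEuniv : ∀ r, ∃ j, r ∈ E j := by
    intro r
    have h1 : r ∈ ⋃ i, spanningSets μ i := by rw [iUnion_spanningSets]; trivial
    obtain ⟨i, hi⟩ := mem_iUnion.1 h1
    obtain ⟨j, hj⟩ := exists_nat_ge (max |X r| (max (f r) |(β r (f r)).toReal|))
    have hj' : (j : ℝ) ≤ (max i j : ℕ) := by exact_mod_cast le_max_right i j
    refine ⟨max i j, monotone_spanningSets μ (le_max_left _ _) hi, ?_, ?_, ?_⟩
    · exact ((le_max_left _ _).trans hj).trans hj'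
    · exact (((le_max_left _ _).trans (le_max_right _ _)).trans hj).trans hj'
    · exact (((le_max_right _ _).trans (le_max_right _ _)).trans hj).trans hj'
  have hEfin : ∀ j, μ (E j) < ⊤ := fun j =>
    (measure_mono inter_subset_left).trans_lt (measure_spanningSets_lt_top μ j)
  have bound : ∀ j, ∫⁻ r in E j, ENNReal.ofReal (ℓ r) ∂μ ≤
      ENNReal.ofReal (∫ r, (d * (β r (p₀ r)).toReal + (a + c * X r) * p₀ r) ∂μ - C) := by
    intro j
    classical
    have hbdd : ∀ h : Ω → ℝ, Measurable h → (∃ B : ℝ, ∀ r ∈ E j, |h r| ≤ B) →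
        IntegrableOn h (E j) μ := by
      rintro h hm ⟨B, hB⟩
      refine Measure.integrableOn_of_bounded (M := B) (hEfin j).ne hm.aestronglyMeasurable ?_
      exact (ae_restrict_iff' (hEm j)).2 (Eventually.of_forall hB)
    have iE1 : IntegrableOn f (E j) μ :=
      hbdd f hf ⟨j, fun r hr => by rw [abs_of_nonneg (hf0 r)]; exact hr.2.2.1⟩
    have iE2 : IntegrableOn (fun r => X r * f r) (E j) μ := by
      refine hbdd _ (hXm.mul hf) ⟨j * j, fun r hr => ?_⟩
      rw [abs_mul, abs_of_nonneg (hf0 r)]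
      exact mul_le_mul hr.2.1 hr.2.2.1 (hf0 r) (Nat.cast_nonneg j)
    have iE3 : IntegrableOn (fun r => (β r (f r)).toReal) (E j) μ :=
      hbdd _ hbm ⟨j, fun r hr => hr.2.2.2⟩
    have hg : Admissible μ β X ((E j).piecewise f p₀)
        ((E j).piecewise (fun r => (β r (f r)).toReal) (fun r => (β r (p₀ r)).toReal)) := by
      refine ⟨Measurable.piecewise (hEm j) hf h0.meas, fun r => ?_,
        Integrable.piecewise (hEm j) iE1 h0.int.integrableOn, ?_,
        Integrable.piecewise (hEm j) iE3 h0.intu.integrableOn, ?_⟩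
      · by_cases hr : r ∈ E j <;> simp [hr, hf0 r, h0.nonneg r]
      · refine (Integrable.piecewise (hEm j) iE2 h0.intX.integrableOn).congr
          (Eventually.of_forall fun r => ?_)
        by_cases hr : r ∈ E j <;> simp [hr]
      · filter_upwards [h0.le, hfin] with r hr1 hr2
        by_cases hr : r ∈ E j
        · simp only [hr, piecewise_eq_of_mem]
          exact (EReal.coe_toReal hr2 (hst.betaNeBot _ _)).ge
        · simpa only [hr, not_false_eq_true, piecewise_eq_of_notMem] using hr1
    obtain ⟨ig, eg⟩ := integral_lagrangian hg a c d
    obtain ⟨i0, -⟩ := integral_lagrangian h0 a c d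
    have hCg := hC _ _ hg
    rw [← eg] at hCg
    have hind : (fun r => (d * (β r (p₀ r)).toReal + (a + c * X r) * p₀ r) -
        (d * (E j).piecewise (fun r => (β r (f r)).toReal) (fun r => (β r (p₀ r)).toReal) r +
          (a + c * X r) * (E j).piecewise f p₀ r)) = (E j).indicator ℓ := by
      funext r
      by_cases hr : r ∈ E j <;> simp [hr, hℓ]
    have hint := integral_sub i0 ig
    rw [hind, integral_indicator (hEm j)] at hint
    have iℓ : IntegrableOn ℓ (E j) μ := by
      rw [← integrable_indicator_iff (hEm j), ← hind]
      exact i0.sub ig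
    rw [← ofReal_integral_eq_lintegral_ofReal iℓ (Eventually.of_forall hℓ0)]
    exact ENNReal.ofReal_le_ofReal (by linarith)
  have hsup : ∀ r, ENNReal.ofReal (ℓ r) = ⨆ j, (E j).indicator (fun r => ENNReal.ofReal (ℓ r)) r := by
    intro r
    refine le_antisymm ?_ (iSup_le fun j => indicator_le_self _ _ r)
    obtain ⟨j, hj⟩ := hEuniv r
    refine le_iSup_of_le j ?_
    rw [indicator_of_mem hj]
  calc ∫⁻ r, ENNReal.ofReal (ℓ r) ∂μ
      = ∫⁻ r, ⨆ j, (E j).indicator (fun r => ENNReal.ofReal (ℓ r)) r ∂μ :=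
        lintegral_congr hsup
    _ = ⨆ j, ∫⁻ r, (E j).indicator (fun r => ENNReal.ofReal (ℓ r)) r ∂μ :=
        lintegral_iSup (fun j => hℓm.ennreal_ofReal.indicator (hEm j))
          (fun i j hij r => indicator_le_indicator_of_subset (hEmono hij) (fun _ => zero_le) r)
    _ ≤ _ := iSup_le fun j => by
        rw [lintegral_indicator (hEm j)]
        exact bound j

/-- Interchange of infimum and integration over the admissible functions. -/
theorem exists_integrable_minorant (hst : Standing μ β β' X p₀ b₀) {a c d C : ℝ}
    (hC : ∀ f u, Admissible μ β X f u →
      C ≤ a * ∫ r, f r ∂μ + c * ∫ r, X r * f r ∂μ + d * ∫ r, u r ∂μ) :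
    ∃ w : Ω → ℝ, Integrable w μ ∧ C ≤ ∫ r, w r ∂μ ∧
      ∀ᵐ r ∂μ, ∀ q : ℚ, 0 < q → w r ≤ d * (β r q).toReal + (a + c * X r) * q := by
  have h0 := hst.admissible_p₀
  have hXm := hst.Xmeas
  obtain ⟨i0, e0⟩ := integral_lagrangian h0 a c d
  have : Nonempty {q : ℚ // 0 < q} := ⟨⟨1, one_pos⟩⟩
  obtain ⟨e, he⟩ := exists_surjective_nat {q : ℚ // 0 < q}
  set φ : Ω → ℝ → ℝ := fun r s => d * (β r s).toReal + (a + c * X r) * s with hφ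
  set q : ℕ → ℝ := fun n => ((e n).1 : ℝ) with hq
  have hqpos : ∀ n, 0 < q n := fun n => by simpa [hq] using (e n).2
  set f := runningArgmin φ p₀ q with hfdef
  have hf0 : ∀ n r, 0 ≤ f n r := by
    intro n r
    rcases runningArgmin_cases φ p₀ q n r with h | ⟨m, h⟩
    · rw [hfdef, h]; exact h0.nonneg r
    · rw [hfdef, h]; exact (hqpos m).le
  have hfin : ∀ n, ∀ᵐ r ∂μ, β r (f n r) ≠ ⊤ := by
    intro n
    filter_upwards [h0.le] with r hr
    rcases runningArgmin_cases φ p₀ q n r with h | ⟨m, h⟩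
    · rw [hfdef, h]; exact ne_top_of_le_ne_top (EReal.coe_ne_top _) hr
    · rw [hfdef, h]; exact hst.betaFin r _ (hqpos m)
  have hφm : ∀ {g : Ω → ℝ}, Measurable g → (∀ r, 0 ≤ g r) → Measurable fun r => φ r (g r) := by
    intro g hg hg0
    have := (hst.measurable_beta_comp hg hg0).ereal_toReal
    simp only [hφ]
    fun_prop
  have hfm : ∀ n, Measurable (f n) := by
    intro n
    induction n with
    | zero => exact h0.meas
    | succ n ih =>
      exact Measurable.ite (measurableSet_lt
        (hφm (measurable_const (a := q n)) fun _ => (hqpos n).le) (hφm ih (hf0 n)))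
        measurable_const ih
  set L : ℕ → Ω → ℝ≥0∞ := fun n r => ENNReal.ofReal (φ r (p₀ r) - φ r (f n r)) with hL
  have hLm : ∀ n, Measurable (L n) := fun n =>
    ((hφm h0.meas h0.nonneg).sub (hφm (hfm n) (hf0 n))).ennreal_ofReal
  have hLle : ∫⁻ r, ⨆ n, L n r ∂μ ≤ ENNReal.ofReal (∫ r, φ r (p₀ r) ∂μ - C) := by
    rw [lintegral_iSup hLm]
    · exact iSup_le fun n => hst.lintegral_gain_le hC (hfm n) (hf0 n) (hfin n)
        fun r => runningArgmin_antitone φ p₀ q r (Nat.zero_le n)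
    · intro i j hij r
      have := runningArgmin_antitone φ p₀ q r hij
      exact ENNReal.ofReal_le_ofReal (sub_le_sub_left this _)
  have hLtop : ∫⁻ r, ⨆ n, L n r ∂μ ≠ ⊤ := ne_top_of_le_ne_top ENNReal.ofReal_ne_top hLle
  have hsm : Measurable fun r => ⨆ n, L n r := Measurable.iSup hLm
  have iL : Integrable (fun r => (⨆ n, L n r).toReal) μ :=
    integrable_toReal_of_lintegral_ne_top hsm.aemeasurable hLtop
  refine ⟨fun r => φ r (p₀ r) - (⨆ n, L n r).toReal, i0.sub iL, ?_, ?_⟩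
  · rw [integral_sub i0 iL, integral_toReal hsm.aemeasurable (ae_lt_top hsm hLtop)]
    have h1 := ENNReal.toReal_mono ENNReal.ofReal_ne_top hLle
    have h2 : C ≤ ∫ r, φ r (p₀ r) ∂μ := by
      rw [e0]; exact hC _ _ h0
    rw [ENNReal.toReal_ofReal (by linarith)] at h1
    linarith
  · filter_upwards [ae_lt_top hsm hLtop] with r hr s hs
    obtain ⟨n, hn⟩ := he ⟨s, hs⟩
    have h1 : L (n + 1) r ≤ ⨆ n, L n r := le_iSup (fun n => L n r) (n + 1)
    have h2 := (ENNReal.ofReal_le_iff_le_toReal hr.ne).1 h1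
    have h3 := (runningArgmin_succ_le φ p₀ q n r).2
    have h4 : q n = (s : ℝ) := by simp [hq, hn]
    rw [h4] at h3
    change φ r (p₀ r) - (⨆ n, L n r).toReal ≤ φ r s
    linarith

/-- Existence of dual parameters certifying a lower bound `v` for the payoff under `H ≤ k`. -/
theorem exists_dual (hst : Standing μ β β' X p₀ b₀) {k v : ℝ} (hk : 0 < k)
    (hX : ¬ ∀ᵐ r ∂μ, v ≤ X r)
    (hP : ∀ f u, Admissible μ β X f u → ∫ r, f r ∂μ = 1 → ∫ r, u r ∂μ ≤ k →
      v ≤ ∫ r, X r * f r ∂μ) :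
    ∃ θ₁ θ₂ : ℝ, θ₂ < 0 ∧ Kfun μ β X θ₁ θ₂ ≤ ((θ₁ + θ₂ * v - k : ℝ) : EReal) := by
  have h0 := hst.admissible_p₀
  set S : Set (ℝ × ℝ × ℝ) := {z | ∃ f u, Admissible μ β X f u ∧ ∫ r, f r ∂μ = z.1 ∧
    ∫ r, X r * f r ∂μ < z.2.1 ∧ ∫ r, u r ∂μ ≤ z.2.2} with hS
  have hconv : Convex ℝ S := by
    rintro ⟨x1, x2, x3⟩ ⟨f, u, hf, hf1, hf2, hf3⟩ ⟨y1, y2, y3⟩ ⟨g, w, hg, hg1, hg2, hg3⟩ c d hc hd hcd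
    refine ⟨_, _, hst.admissible_mix hf hg hc hd hcd, ?_, ?_, ?_⟩
    · rw [integral_mix hf.int hg.int, hf1, hg1]; simp
    · rw [integral_X_mix hf hg]
      simp only [Prod.snd_add, Prod.smul_snd, Prod.fst_add, Prod.smul_fst, smul_eq_mul] at *
      rcases hc.eq_or_lt with rfl | hc
      · obtain rfl : d = 1 := by linarith
        linarith
      · nlinarith
    · rw [integral_mix hf.intu hg.intu]
      simp only [Prod.snd_add, Prod.smul_snd, smul_eq_mul] at *
      gcongr
  have hne : S.Nonempty := ⟨(1, b₀ + 1, 0), p₀, _, h0, hst.dens₀.integral_eq_one,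
    by rw [hst.integral_X_p₀]; simp, hst.integral_beta_p₀.le⟩
  have hx : ((1, v, k) : ℝ × ℝ × ℝ) ∉ S := by
    rintro ⟨f, u, hf, h1, h2, h3⟩
    exact absurd (hP f u hf h1 h3) (not_le.2 h2)
  obtain ⟨F, hF0, hF⟩ := exists_separating_functional hconv hne hx
  set a := F (1, 0, 0) with ha
  set c := F (0, 1, 0) with hc
  set d := F (0, 0, 1) with hd
  have hFeq : ∀ x y z : ℝ, F (x, y, z) = a * x + c * y + d * z := by
    intro x y z
    have : ((x, y, z) : ℝ × ℝ × ℝ) = x • (1, 0, 0) + y • (0, 1, 0) + z • (0, 0, 1) := by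
      simp
    rw [this, map_add, map_add, map_smul, map_smul, map_smul]
    simp only [smul_eq_mul]
    ring
  have hmain : ∀ f u, Admissible μ β X f u → ∀ s t : ℝ, 0 < s → 0 ≤ t →
      a * 1 + c * v + d * k ≤
        a * ∫ r, f r ∂μ + c * (∫ r, X r * f r ∂μ + s) + d * (∫ r, u r ∂μ + t) := by
    intro f u hf s t hs ht
    have := hF (∫ r, f r ∂μ, ∫ r, X r * f r ∂μ + s, ∫ r, u r ∂μ + t)
      ⟨f, u, hf, rfl, by simpa using hs, by simpa using ht⟩
    rwa [hFeq, hFeq] at this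
  have hm0 : ∀ s t : ℝ, 0 < s → 0 ≤ t → c * v + d * k ≤ c * (b₀ + s) + d * t := by
    intro s t hs ht
    have := hmain _ _ h0 s t hs ht
    rw [hst.dens₀.integral_eq_one, hst.integral_X_p₀, hst.integral_beta_p₀] at this
    linarith
  have hc0 : 0 ≤ c := by
    by_contra! hneg
    have hs : 0 < (|c * v + d * k - c * b₀| + 1) / (-c) := by
      have := neg_pos.2 hneg; positivity
    have h1 := hm0 _ 0 hs le_rfl
    have h2 : c * ((|c * v + d * k - c * b₀| + 1) / (-c)) = -(|c * v + d * k - c * b₀| + 1) := by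
      have hne : c ≠ 0 := hneg.ne
      field_simp
    have h3 := neg_abs_le (c * v + d * k - c * b₀)
    linarith
  have hd0 : 0 ≤ d := by
    by_contra! hneg
    have hs : 0 < (|c * v + d * k - c * (b₀ + 1)| + 1) / (-d) := by
      have := neg_pos.2 hneg; positivity
    have h1 := hm0 1 _ one_pos hs.le
    have h2 : d * ((|c * v + d * k - c * (b₀ + 1)| + 1) / (-d)) =
        -(|c * v + d * k - c * (b₀ + 1)| + 1) := by
      have hne : d ≠ 0 := hneg.ne
      field_simp
    have h3 := neg_abs_le (c * v + d * k - c * (b₀ + 1))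
    linarith
  have hlim : ∀ {A B : ℝ}, (∀ s : ℝ, 0 < s → A ≤ B + c * s) → A ≤ B := by
    intro A B h
    refine le_of_forall_pos_le_add fun η hη => ?_
    refine (h (η / (c + 1)) (by positivity)).trans ?_
    have : c * (η / (c + 1)) ≤ η := by
      rw [mul_div_assoc', div_le_iff₀ (by positivity)]
      nlinarith
    linarith
  have hC : ∀ f u, Admissible μ β X f u →
      a + c * v + d * k ≤ a * ∫ r, f r ∂μ + c * ∫ r, X r * f r ∂μ + d * ∫ r, u r ∂μ := by
    intro f u hf
    refine hlim fun s hs => ?_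
    have := hmain f u hf s 0 hs le_rfl
    linarith
  obtain ⟨w, hwi, hwC, hw⟩ := hst.exists_integrable_minorant hC
  have hdk : d * k ≤ c * (b₀ - v) := by
    refine hlim fun s hs => ?_
    have := hm0 s 0 hs le_rfl
    linarith
  rcases hd0.eq_or_lt with hd1 | hd1
  · exfalso
    rw [← hd1] at hw hwC
    simp only [zero_mul, zero_add, add_zero] at hw hwC
    have hY : ∀ᵐ r ∂μ, 0 ≤ a + c * X r ∧ w r ≤ 0 := by
      filter_upwards [hw] with r hr
      constructor
      · by_contra! hneg
        obtain ⟨q, hq⟩ := exists_rat_gt (max 1 (w r / (a + c * X r)))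
        have hq1 : (1:ℝ) < q := (le_max_left _ _).trans_lt hq
        have hq2 : w r / (a + c * X r) < q := (le_max_right _ _).trans_lt hq
        rw [div_lt_iff_of_neg hneg] at hq2
        have := hr q (by have := one_pos.trans hq1; exact_mod_cast this)
        linarith
      · by_contra! hpos
        obtain ⟨q, hq1, hq2⟩ := exists_rat_btwn
          (show (0:ℝ) < w r / (|a + c * X r| + 1) by positivity)
        rw [lt_div_iff₀ (by positivity)] at hq2
        have h1 := hr q (by exact_mod_cast hq1)
        nlinarith [le_abs_self (a + c * X r)]
    have hC0 : a + c * v ≤ 0 :=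
      hwC.trans (integral_nonpos_of_ae (hY.mono fun r hr => hr.2))
    rcases hc0.eq_or_lt with hc1 | hc1
    · have ha0 : a = 0 := by
        rw [← hc1] at hY hC0
        simp only [zero_mul, add_zero] at hY hC0
        by_contra hne
        refine hX (hY.mono fun r hr => absurd (le_antisymm hC0 hr.1) hne)
      refine hF0 (LinearMap.ext fun z => ?_)
      obtain ⟨x, y, z⟩ := z
      rw [hFeq, ha0, ← hc1, ← hd1]
      simp
    · refine hX (hY.mono fun r hr => ?_)
      by_contra! hlt
      nlinarith [hr.1]
  · have hcpos : 0 < c := by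
      rcases hc0.eq_or_lt with hc1 | hc1
      · rw [← hc1] at hdk
        nlinarith
      · exact hc1
    refine ⟨-a / d, -c / d, div_neg_of_neg_of_pos (neg_neg_of_pos hcpos) hd1, ?_⟩
    have hle : ∀ᵐ r ∂μ, conjβ β r (-a / d + -c / d * X r) ≤ ((-(w r) / d : ℝ) : EReal) := by
      filter_upwards [hw] with r hr
      refine hst.conj_le_of_forall_rat r _ fun q hq => ?_
      rw [EReal.coe_le_coe_iff, le_div_iff₀ hd1]
      have h1 := hr q hq
      have h2 : ((q : ℝ) * (-a / d + -c / d * X r) - (β r q).toReal) * d =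
          -(d * (β r q).toReal + (a + c * X r) * q) := by
        field_simp; ring
      linarith
    refine (eInt_mono_ae hle).trans ?_
    have iw : Integrable (fun r => -(w r) / d) μ := hwi.neg.div_const d
    rw [eInt_coe iw, EReal.coe_le_coe_iff, integral_div]
    simp only [integral_neg]
    rw [div_le_iff₀ hd1]
    have : (-a / d + -c / d * v - k) * d = -(a + c * v + d * k) := by field_simp; ring
    rw [this]
    linarith

end Standing

end Interchange



section Localiser

variable {Ω : Type*} [MeasurableSpace Ω] {μ : Measure Ω} {β : Ω → ℝ → EReal} {β' : Ω → ℝ → ℝ}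
  {X p₀ : Ω → ℝ} {b₀ : ℝ}

namespace Standing

theorem Kfun_ne_bot (hst : Standing μ β β' X p₀ b₀) (θ₁ θ₂ : ℝ) : Kfun μ β X θ₁ θ₂ ≠ ⊥ := by
  have h0 := hst.admissible_p₀
  have hint : Integrable
      (fun r => p₀ r * (θ₁ + θ₂ * X r) - (β r (p₀ r)).toReal) μ := by
    refine (((h0.int.const_mul θ₁).add (h0.intX.const_mul θ₂)).sub h0.intu).congr
      (Eventually.of_forall fun r => ?_)
    simp only [Pi.add_apply, Pi.sub_apply]
    ring
  have hle : ∀ᵐ r ∂μ, ((p₀ r * (θ₁ + θ₂ * X r) - (β r (p₀ r)).toReal : ℝ) : EReal) ≤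
      conjβ β r (θ₁ + θ₂ * X r) := by
    filter_upwards [h0.le] with r hr
    exact hst.coe_le_conj r (ne_top_of_le_ne_top (EReal.coe_ne_top _) hr) _
  have := eInt_mono_ae hle
  rw [eInt_coe hint] at this
  exact ne_bot_of_le_ne_bot (EReal.coe_ne_bot _) this

theorem Kfun_finite (hst : Standing μ β β' X p₀ b₀) {θ₁ θ₂ κ : ℝ}
    (hK : Kfun μ β X θ₁ θ₂ = (κ : EReal)) :
    (∀ᵐ r ∂μ, conjβ β r (θ₁ + θ₂ * X r) ≠ ⊤) ∧
      Integrable (fun r => (conjβ β r (θ₁ + θ₂ * X r)).toReal) μ ∧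
      ∫ r, (conjβ β r (θ₁ + θ₂ * X r)).toReal ∂μ = κ := by
  have hm : Measurable fun r => conjβ β r (θ₁ + θ₂ * X r) :=
    hst.measurable_conj_comp ((hst.Xmeas.const_mul θ₂).const_add θ₁)
  have hK' : eInt μ (fun r => conjβ β r (θ₁ + θ₂ * X r)) = (κ : EReal) := hK
  obtain ⟨h1, h2, h3⟩ := eInt_finite hm (hK' ▸ EReal.coe_ne_bot κ) (hK' ▸ EReal.coe_ne_top κ)
  refine ⟨h1.mono fun r hr => hr ▸ EReal.coe_ne_top _, h2, ?_⟩
  rw [hK'] at h3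
  exact (EReal.coe_eq_coe_iff.1 h3).symm

theorem Hfun_finite (hst : Standing μ β β' X p₀ b₀) {p : Ω → ℝ} (hp : IsDensity μ p)
    (hH : Hfun μ β p ≠ ⊤) :
    (∀ᵐ r ∂μ, β r (p r) ≠ ⊤) ∧ Integrable (fun r => (β r (p r)).toReal) μ ∧
      Hfun μ β p = ((∫ r, (β r (p r)).toReal ∂μ : ℝ) : EReal) := by
  obtain ⟨h1, h2, h3⟩ := eInt_finite (hst.measurable_beta_comp hp.1 hp.2.1)
    (ne_bot_of_le_ne_bot (by simp) (hst.Hnonneg p hp)) hH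
  exact ⟨h1.mono fun r hr => hr ▸ EReal.coe_ne_top _, h2, h3⟩

/-- The Fenchel gap `β(p) - τ p + β*(τ)` with `τ = θ₁ + θ₂ X` is nonnegative and integrable, and
its integral is expressed through the entropy, the payoff and `K`. -/
theorem fenchel_gap (hst : Standing μ β β' X p₀ b₀) {θ₁ θ₂ κ : ℝ} (hθ : θ₂ < 0)
    (hK : Kfun μ β X θ₁ θ₂ = (κ : EReal)) {p : Ω → ℝ} (hp : IsDensity μ p)
    (hH : Hfun μ β p ≠ ⊤) (hx : xInt μ X p ≠ ⊤) :
    ∃ h x : ℝ, Hfun μ β p = (h : EReal) ∧ xInt μ X p = (x : EReal) ∧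
      (∀ᵐ r ∂μ, β r (p r) ≠ ⊤) ∧
      0 ≤ h - θ₁ - θ₂ * x + κ ∧
      eInt μ (fun r => (((β r (p r)).toReal - (θ₁ + θ₂ * X r) * p r +
        (conjβ β r (θ₁ + θ₂ * X r)).toReal : ℝ) : EReal)) =
        ((h - θ₁ - θ₂ * x + κ : ℝ) : EReal) := by
  obtain ⟨hc, ic, ec⟩ := hst.Kfun_finite hK
  obtain ⟨hb, ib, eb⟩ := hst.Hfun_finite hp hH
  have ip := hp.integrable
  have hgap : ∀ᵐ r ∂μ, 0 ≤ (β r (p r)).toReal - (θ₁ + θ₂ * X r) * p r +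
      (conjβ β r (θ₁ + θ₂ * X r)).toReal := by
    filter_upwards [hc, hb] with r hr1 hr2
    have h1 := hst.coe_le_conj r hr2 (θ₁ + θ₂ * X r)
    rw [← EReal.coe_toReal hr1 (hst.conj_ne_bot r _), EReal.coe_le_coe_iff] at h1
    linarith
  have iR : Integrable (fun r => ((β r (p r)).toReal + (conjβ β r (θ₁ + θ₂ * X r)).toReal -
      θ₁ * p r) / (-θ₂)) μ := ((ib.add ic).sub (ip.const_mul θ₁)).div_const _
  have hneg : ∫⁻ r, ENNReal.ofReal (-(X r * p r)) ∂μ ≠ ⊤ := by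
    refine ne_top_of_le_ne_top iR.lintegral_lt_top.ne (lintegral_mono_ae ?_)
    filter_upwards [hgap] with r hr
    refine ENNReal.ofReal_le_ofReal ?_
    rw [le_div_iff₀ (neg_pos.2 hθ)]
    linarith
  have hpos : ∫⁻ r, ENNReal.ofReal (X r * p r) ∂μ ≠ ⊤ := by
    have := lintegral_ePos_ne_top (μ := μ) (f := fun r => ((X r * p r : ℝ) : EReal))
      (by simpa only [← EReal.coe_neg, ePos_coe] using hneg) hx
    simpa only [ePos_coe] using this
  have iX : Integrable (fun r => X r * p r) μ :=
    integrable_of_lintegral_ofReal (hst.Xmeas.mul hp.1) hpos hneg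
  have iG : Integrable (fun r => (β r (p r)).toReal - (θ₁ + θ₂ * X r) * p r +
      (conjβ β r (θ₁ + θ₂ * X r)).toReal) μ := by
    refine ((ib.sub ((ip.const_mul θ₁).add (iX.const_mul θ₂))).add ic).congr
      (Eventually.of_forall fun r => ?_)
    simp only [Pi.add_apply, Pi.sub_apply]
    ring
  have eG : ∫ r, ((β r (p r)).toReal - (θ₁ + θ₂ * X r) * p r +
      (conjβ β r (θ₁ + θ₂ * X r)).toReal) ∂μ =
      ∫ r, (β r (p r)).toReal ∂μ - θ₁ - θ₂ * ∫ r, X r * p r ∂μ + κ := by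
    have e1 : ∀ r, (β r (p r)).toReal - (θ₁ + θ₂ * X r) * p r +
        (conjβ β r (θ₁ + θ₂ * X r)).toReal = (β r (p r)).toReal -
        (θ₁ * p r + θ₂ * (X r * p r)) + (conjβ β r (θ₁ + θ₂ * X r)).toReal := fun r => by ring
    have i2 : Integrable (fun r => θ₁ * p r + θ₂ * (X r * p r)) μ :=
      (ip.const_mul θ₁).add (iX.const_mul θ₂)
    have i3 : Integrable (fun r => (β r (p r)).toReal - (θ₁ * p r + θ₂ * (X r * p r))) μ :=
      ib.sub i2
    simp only [e1]
    rw [integral_add i3 ic, integral_sub ib i2, integral_mix ip iX,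
      hp.integral_eq_one, ec]
    ring
  refine ⟨_, _, eb, eInt_coe iX, hb, ?_, ?_⟩
  · rw [← eG]
    exact integral_nonneg_of_ae hgap
  · rw [eInt_coe iG, eG]

/-- A dual certificate for `v` bounds the maximal dual value from below by `v`. -/
theorem isWCLParam_bound (hst : Standing μ β β' X p₀ b₀) {k θ₁ θ₂ v : ℝ}
    (hwcl : IsWCLParam μ β X k θ₁ θ₂)
    (hd : ∃ θ₁' θ₂' : ℝ, θ₂' < 0 ∧ Kfun μ β X θ₁' θ₂' ≤ ((θ₁' + θ₂' * v - k : ℝ) : EReal)) :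
    ∃ κ : ℝ, Kfun μ β X θ₁ θ₂ = (κ : EReal) ∧ k + κ - θ₁ ≤ θ₂ * v := by
  obtain ⟨η₁, η₂, hη, hle⟩ := hd
  have h1 := hwcl.2 η₁ η₂ hη
  have hη' := EReal.coe_toReal (ne_top_of_le_ne_top (EReal.coe_ne_top _) hle)
    (hst.Kfun_ne_bot η₁ η₂)
  set κ' := (Kfun μ β X η₁ η₂).toReal
  rw [← hη', EReal.coe_le_coe_iff] at hle
  rw [← hη', ← EReal.coe_add, ← EReal.coe_sub, ← EReal.coe_div] at h1
  have hv : v ≤ (k + κ' - η₁) / η₂ := by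
    rw [le_div_iff_of_neg hη]
    linarith
  have hθ := hwcl.1
  have hKt : Kfun μ β X θ₁ θ₂ ≠ ⊤ := by
    intro h
    rw [h, EReal.coe_add_top, EReal.top_sub_coe,
      EReal.top_div_of_neg_ne_bot (by exact_mod_cast hθ) (EReal.coe_ne_bot _)] at h1
    exact EReal.coe_ne_bot _ (le_bot_iff.1 h1)
  refine ⟨(Kfun μ β X θ₁ θ₂).toReal, (EReal.coe_toReal hKt (hst.Kfun_ne_bot _ _)).symm, ?_⟩
  rw [← EReal.coe_toReal hKt (hst.Kfun_ne_bot _ _), ← EReal.coe_add, ← EReal.coe_sub,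
    ← EReal.coe_div, EReal.coe_le_coe_iff] at h1
  have h2 := hv.trans h1
  rw [le_div_iff_of_neg hθ] at h2
  linarith

theorem not_ae_le_of_essInfX_lt {b v : ℝ} (hb : essInfX μ X < (b : EReal)) (hv : b ≤ v) :
    ¬ ∀ᵐ r ∂μ, v ≤ X r := fun h =>
  absurd (le_essInf_of_ae_le (b : EReal)
    (h.mono fun r hr => EReal.coe_le_coe_iff.2 (hv.trans hr))) (not_le.2 hb)

/-- If `k < F(b)` with `b < b₀` then every admissible density with entropy at most `k` has payoff
at least `b`. -/
theorem le_integral_of_lt_Ffun (hst : Standing μ β β' X p₀ b₀) {k b : ℝ} (hk : 0 < k)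
    (hb : b < b₀) (hF : (k : EReal) < Ffun μ β X b) {f u : Ω → ℝ} (hf : Admissible μ β X f u)
    (h1 : ∫ r, f r ∂μ = 1) (hu : ∫ r, u r ∂μ ≤ k) : b ≤ ∫ r, X r * f r ∂μ := by
  by_contra! hlt
  set x := ∫ r, X r * f r ∂μ with hx
  have hpos : 0 < b₀ - x := by linarith
  have ht0 : 0 ≤ (b₀ - b) / (b₀ - x) := div_nonneg (by linarith) hpos.le
  have ht1 : (b₀ - b) / (b₀ - x) ≤ 1 := by rw [div_le_one hpos]; linarith
  have hte : (b₀ - b) / (b₀ - x) * (b₀ - x) = b₀ - b := div_mul_cancel₀ _ hpos.ne'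
  set t := (b₀ - b) / (b₀ - x)
  have h0 := hst.admissible_p₀
  have hmix := hst.admissible_mix hf h0 ht0 (sub_nonneg.2 ht1) (by ring)
  have hone : ∫ r, (t * f r + (1 - t) * p₀ r) ∂μ = 1 := by
    rw [integral_mix hf.int h0.int, h1, hst.dens₀.integral_eq_one]; ring
  have hpay : ∫ r, X r * (t * f r + (1 - t) * p₀ r) ∂μ = b := by
    rw [integral_X_mix hf h0, hst.integral_X_p₀, ← hx]; linarith
  have hH : ∫ r, (t * u r + (1 - t) * (β r (p₀ r)).toReal) ∂μ ≤ k := by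
    rw [integral_mix hf.intu h0.intu, hst.integral_beta_p₀]
    nlinarith
  refine absurd hF (not_lt.2 ?_)
  exact (iInf_le _ ⟨_, hmix.isDensity hone, by rw [hmix.xInt_eq, hpay]⟩).trans
    (hmix.Hfun_le.trans (EReal.coe_le_coe_iff.2 hH))

/-- The value `V(k)` is finite, and the worst case parameters satisfy `k + K - θ₁ ≤ θ₂ V(k)`. -/
theorem exists_value (hst : Standing μ β β' X p₀ b₀) {k θ₁ θ₂ : ℝ} (hk : 0 < k)
    (hkmax : (k : EReal) < kmax μ β X b₀) (hwcl : IsWCLParam μ β X k θ₁ θ₂) :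
    ∃ v κ : ℝ, Vfun μ β X k = (v : EReal) ∧ Kfun μ β X θ₁ θ₂ = (κ : EReal) ∧
      k + κ - θ₁ ≤ θ₂ * v := by
  obtain ⟨⟨b, hb1, hb2⟩, hF⟩ := lt_iSup_iff.1 hkmax
  have hθ := hwcl.1
  obtain ⟨κ, hκ, hκb⟩ := hst.isWCLParam_bound hwcl (hst.exists_dual hk
    (not_ae_le_of_essInfX_lt hb1 le_rfl)
    fun f u hf h1 hu => hst.le_integral_of_lt_Ffun hk hb2 hF hf h1 hu)
  have hVb : (b : EReal) ≤ Vfun μ β X k := by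
    refine le_iInf fun ⟨p, hp, hH⟩ => ?_
    by_cases hx : xInt μ X p = ⊤
    · exact hx ▸ le_top
    obtain ⟨h, x, eh, ex, -, h0, -⟩ := hst.fenchel_gap hθ hκ hp
      (ne_top_of_le_ne_top (EReal.coe_ne_top _) hH) hx
    rw [eh, EReal.coe_le_coe_iff] at hH
    change (b : EReal) ≤ xInt μ X p
    rw [ex, EReal.coe_le_coe_iff]
    nlinarith
  have hV0 : Vfun μ β X k ≤ (b₀ : EReal) := by
    rw [← hst.payoff₀]
    exact iInf_le_of_le ⟨p₀, hst.dens₀, by rw [hst.H₀]; exact_mod_cast hk.le⟩ le_rfl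
  have hV := EReal.coe_toReal (ne_top_of_le_ne_top (EReal.coe_ne_top _) hV0)
    (ne_bot_of_le_ne_bot (EReal.coe_ne_bot _) hVb)
  set v := (Vfun μ β X k).toReal
  rw [← hV, EReal.coe_le_coe_iff] at hVb hV0
  obtain ⟨κ', hκ', hκv⟩ := hst.isWCLParam_bound hwcl (hst.exists_dual hk
    (not_ae_le_of_essInfX_lt hb1 hVb) fun f u hf h1 hu => by
      rw [← EReal.coe_le_coe_iff, hV, ← hf.xInt_eq]
      exact iInf_le_of_le ⟨f, hf.isDensity h1,
        hf.Hfun_le.trans (EReal.coe_le_coe_iff.2 hu)⟩ le_rfl)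
  exact ⟨v, κ', hV.symm, hκ', hκv⟩

/-- The worst case parameters lie in `Θ`. -/
theorem ae_lt_derivTop (hst : Standing μ β β' X p₀ b₀) {k θ₁ θ₂ κ : ℝ}
    (hwcl : IsWCLParam μ β X k θ₁ θ₂) (hK : Kfun μ β X θ₁ θ₂ = (κ : EReal)) :
    ∀ᵐ r ∂μ, ((θ₁ + θ₂ * X r : ℝ) : EReal) < derivTop β' r := by
  obtain ⟨hc, ic, ec⟩ := hst.Kfun_finite hK
  have hθ := hwcl.1
  set L : ℕ → Ω → ℝ := fun n r => ((n : ℝ) + 1) * ((conjβ β r (θ₁ + θ₂ * X r)).toReal -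
    (conjβ β r (θ₁ + θ₂ * X r - 1 / ((n : ℝ) + 1))).toReal) with hL
  have hshift : ∀ n : ℕ, (fun r => conjβ β r (θ₁ + θ₂ * X r - 1 / ((n : ℝ) + 1))) =
      fun r => conjβ β r ((θ₁ - 1 / ((n : ℝ) + 1)) + θ₂ * X r) := fun n => by
    funext r
    congr 1
    ring
  have hLm : ∀ n, Measurable (L n) := fun n =>
    (((hst.measurable_conj_comp ((hst.Xmeas.const_mul θ₂).const_add θ₁)).ereal_toReal).sub
      ((hst.measurable_conj_comp
        (((hst.Xmeas.const_mul θ₂).const_add θ₁).sub_const _)).ereal_toReal)).const_mul _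
  have hLint : ∀ n, ∫⁻ r, ENNReal.ofReal (L n r) ∂μ ≤ 1 := by
    intro n
    have hn : (0 : ℝ) < (n : ℝ) + 1 := by positivity
    set δ : ℝ := 1 / ((n : ℝ) + 1) with hδ
    have hδ0 : 0 < δ := by positivity
    have hle : Kfun μ β X (θ₁ - δ) θ₂ ≤ (κ : EReal) := by
      rw [← hK]
      exact eInt_mono_ae (Eventually.of_forall fun r => hst.conj_mono r (by linarith))
    have hK' := EReal.coe_toReal (ne_top_of_le_ne_top (EReal.coe_ne_top _) hle)
      (hst.Kfun_ne_bot (θ₁ - δ) θ₂)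
    set κ' := (Kfun μ β X (θ₁ - δ) θ₂).toReal
    obtain ⟨hc', ic', ec'⟩ := hst.Kfun_finite hK'.symm
    have hmax := hwcl.2 (θ₁ - δ) θ₂ hθ
    rw [← hK', hK, ← EReal.coe_add, ← EReal.coe_sub, ← EReal.coe_div, ← EReal.coe_add,
      ← EReal.coe_sub, ← EReal.coe_div, EReal.coe_le_coe_iff,
      div_le_div_right_of_neg hθ] at hmax
    have hLn : L n = fun r => ((n : ℝ) + 1) * ((conjβ β r (θ₁ + θ₂ * X r)).toReal -
        (conjβ β r ((θ₁ - δ) + θ₂ * X r)).toReal) := by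
      funext r
      simp only [hL]
      rw [congrFun (hshift n) r]
    have iL : Integrable (L n) μ := hLn ▸ (ic.sub ic').const_mul _
    have hL0 : ∀ᵐ r ∂μ, 0 ≤ L n r := by
      filter_upwards [hc] with r hr
      rw [hLn]
      refine mul_nonneg hn.le (sub_nonneg.2 (EReal.toReal_le_toReal ?_ (hst.conj_ne_bot _ _) hr))
      exact hst.conj_mono r (by linarith)
    rw [← ofReal_integral_eq_lintegral_ofReal iL hL0, hLn, integral_const_mul,
      integral_sub ic ic', ec, ec', ENNReal.ofReal_le_one]
    calc ((n : ℝ) + 1) * (κ - κ') ≤ ((n : ℝ) + 1) * δ :=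
          mul_le_mul_of_nonneg_left (by linarith) hn.le
      _ = 1 := by rw [hδ]; field_simp
  have hfatou : ∫⁻ r, liminf (fun n => ENNReal.ofReal (L n r)) atTop ∂μ ≤ 1 :=
    (lintegral_liminf_le fun n => (hLm n).ennreal_ofReal).trans
      (liminf_le_of_le (by isBoundedDefault) fun b hb => by
        obtain ⟨n, hn⟩ := hb.exists
        exact hn.trans (hLint n))
  have hfin := ae_lt_top (Measurable.liminf fun n => (hLm n).ennreal_ofReal)
    (ne_top_of_le_ne_top ENNReal.one_ne_top hfatou)
  filter_upwards [hfin, hc] with r hr hcr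
  by_contra! hge
  obtain ⟨S, hS⟩ := ENNReal.lt_iff_exists_nnreal_btwn.1 hr
  have hev := hst.eventually_le_conj_diff r hge hcr (S := (S : ℝ) + 1) (by positivity)
  refine absurd hS.1 (not_lt.2 (le_liminf_of_le (by isBoundedDefault) ?_))
  filter_upwards [hev] with n hn
  rw [← ENNReal.ofReal_coe_nnreal]
  exact ENNReal.ofReal_le_ofReal (le_trans (by linarith) hn)

end Standing

end Localiser

/-- Theorem 2(i) of the paper. For `k ∈ (0, k_max)`, with
`q̂_k = p_{θ₁,θ₂}` the worst case localiser (`θ₂ < 0` attaining the double maximum),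
every (ε-γ)-almost worst case density `p` satisfies `B(p, q̂_k) ≤ γ − θ₂ ε`. -/
theorem awcd_in_bregman_ball {Ω : Type*} [MeasurableSpace Ω] (μ : Measure Ω)
    (β : Ω → ℝ → EReal) (β' : Ω → ℝ → ℝ) (ψ : Ω → ℝ → ℝ) (X : Ω → ℝ) (p₀ : Ω → ℝ) (b₀ : ℝ)
    (hst : Standing μ β β' X p₀ b₀) (hψ : IsConjDeriv β β' ψ)
    (k : ℝ) (hk0 : 0 < k) (hkmax : (k : EReal) < kmax μ β X b₀)
    (θ₁ θ₂ : ℝ) (hwcl : IsWCLParam μ β X k θ₁ θ₂)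
    (ε γ : ℝ) (hε : 0 ≤ ε) (hγ : 0 ≤ γ)
    (p : Ω → ℝ) (hp : AWCD μ β X k ε γ p) :
    Bdist μ β β' p (pFam ψ X θ₁ θ₂) ≤ ((γ - θ₂ * ε : ℝ) : EReal) := by

  obtain ⟨hdens, hH, hx⟩ := hp
  obtain ⟨v, κ, hV, hK, hκ⟩ := hst.exists_value hk0 hkmax hwcl
  have hθ := hwcl.1
  rw [hV, ← EReal.coe_add] at hx
  obtain ⟨h, x, eh, ex, hβ, -, hgap⟩ := hst.fenchel_gap hθ hK hdens
    (ne_top_of_le_ne_top (EReal.coe_ne_top _) hH) (ne_top_of_le_ne_top (EReal.coe_ne_top _) hx)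
  rw [eh, EReal.coe_le_coe_iff] at hH
  rw [ex, EReal.coe_le_coe_iff] at hx
  calc Bdist μ β β' p (pFam ψ X θ₁ θ₂) ≤ ((h - θ₁ - θ₂ * x + κ : ℝ) : EReal) := by
        rw [← hgap]
        refine eInt_mono_ae ?_
        filter_upwards [hβ, hst.ae_lt_derivTop hwcl hK] with r hr hτ
        exact hst.bregmanInt_le hψ r hτ (hdens.2.1 r) hr
    _ ≤ ((γ - θ₂ * ε : ℝ) : EReal) := by
        rw [EReal.coe_le_coe_iff]
        nlinarith [mul_nonneg (neg_nonneg.2 hθ.le) (sub_nonneg.2 hx)]
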